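/- If a finite group G admits a factorization G = AB with A and B nilpotent subgroups, then G is solvable. -/

import Mathlib

set_option linter.all false
namespace KW
open Subgroup

section gen
variable {G : Type*} [Group G] [Finite G]

/-- `g` normalizes `P`, from one inclusion (finite groups). -/
lemma mem_nz {P : Subgroup G} {g : G} (h : ∀ x ∈ P, g * x * g⁻¹ ∈ P) :
    g ∈ normalizer (P : Set G) := by
  rw [Subgroup.mem_normalizer_iff]
  intro x
  refine ⟨h x, fun hx => ?_⟩
  have hm : P.map (MulAut.conj g).toMonoidHom = P := by
    apply Subgroup.eq_of_le_of_card_ge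
    · rintro _ ⟨y, hy, rfl⟩
      simpa using h y hy
    · exact (Nat.card_congr (P.equivMapOfInjective (MulAut.conj g).toMonoidHom
        (MulAut.conj g).injective).toEquiv).le
  have : g * x * g⁻¹ ∈ P.map (MulAut.conj g).toMonoidHom := by rw [hm]; exact hx
  obtain ⟨y, hy, hyx⟩ := this
  have hyx' : g * y * g⁻¹ = g * x * g⁻¹ := by simpa using hyx
  have : y = x := by simpa using hyx'
  exact this ▸ hy

lemma nz_conj {P : Subgroup G} {g : G} (h : g ∈ normalizer (P : Set G)) {x : G} (hx : x ∈ P) :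
    g * x * g⁻¹ ∈ P := (Subgroup.mem_normalizer_iff.1 h x).1 hx

lemma nz_conj' {P : Subgroup G} {g : G} (h : g ∈ normalizer (P : Set G)) {x : G} (hx : x ∈ P) :
    g⁻¹ * x * g ∈ P := by
  have := nz_conj (inv_mem h) hx
  simpa using this

/-- conjugate subgroup -/
def cj (g : G) (P : Subgroup G) : Subgroup G := P.map (MulAut.conj g).toMonoidHom

lemma mem_cj {g x : G} {P : Subgroup G} : x ∈ cj g P ↔ g⁻¹ * x * g ∈ P := by
  constructor
  · rintro ⟨y, hy, rfl⟩
    simpa [mul_assoc] using hy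
  · intro h
    exact ⟨_, h, by simp [mul_assoc]⟩

lemma conj_mem_cj {g x : G} {P : Subgroup G} (h : x ∈ P) : g * x * g⁻¹ ∈ cj g P := by
  rw [mem_cj]; simpa [mul_assoc] using h

lemma card_cj (g : G) (P : Subgroup G) : Nat.card (cj g P) = Nat.card P :=
  (Nat.card_congr (P.equivMapOfInjective _ (MulAut.conj g).injective).toEquiv).symm

lemma cj_one (P : Subgroup G) : cj 1 P = P := by ext x; simp [mem_cj]

lemma cj_mul (g h : G) (P : Subgroup G) : cj (g * h) P = cj g (cj h P) := by
  ext x; simp [mem_cj, mul_assoc]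

lemma cj_mono (g : G) {P Q : Subgroup G} (h : P ≤ Q) : cj g P ≤ cj g Q := Subgroup.map_mono h

lemma mem_nz_cj {P : Subgroup G} {g : G} : g ∈ normalizer (P : Set G) ↔ cj g P = P := by
  constructor
  · intro h
    ext x
    rw [mem_cj]
    constructor
    · intro hx
      have := nz_conj h hx
      simpa [mul_assoc] using this
    · intro hx; exact nz_conj' h hx
  · intro h
    apply mem_nz
    intro x hx
    rw [← h]; exact conj_mem_cj hx

lemma nz_of_cj_le {P : Subgroup G} {g : G} (h : cj g P ≤ P) : g ∈ normalizer (P : Set G) :=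
  mem_nz fun _ hx => h (conj_mem_cj hx)

lemma pg_cj {p : ℕ} {P : Subgroup G} (h : IsPGroup p P) (g : G) : IsPGroup p (cj g P) :=
  h.map _

lemma pg_mem {p : ℕ} {P : Subgroup G} (h : IsPGroup p P) {x : G} (hx : x ∈ P) :
    ∃ k, x ^ p ^ k = 1 := by
  obtain ⟨k, hk⟩ := h ⟨x, hx⟩
  exact ⟨k, by simpa [Subtype.ext_iff] using hk⟩

lemma pg_of {p : ℕ} {P : Subgroup G} (h : ∀ x ∈ P, ∃ k, x ^ p ^ k = 1) : IsPGroup p P := by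
  rintro ⟨x, hx⟩
  obtain ⟨k, hk⟩ := h x hx
  exact ⟨k, by simpa [Subtype.ext_iff] using hk⟩

lemma pg_zpowers {p : ℕ} {x : G} (h : ∃ k, x ^ p ^ k = 1) : IsPGroup p (zpowers x) := by
  obtain ⟨k, hk⟩ := h
  apply pg_of
  rintro _ ⟨n, rfl⟩
  refine ⟨k, ?_⟩
  simp only
  rw [← zpow_natCast, ← zpow_mul, mul_comm, zpow_mul, zpow_natCast, hk, one_zpow]

/-! Sylow subgroups of subgroups -/
structure Syl (p : ℕ) (P X : Subgroup G) : Prop where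
  le : P ≤ X
  pg : IsPGroup p P
  nd : ¬ p ∣ P.relIndex X

lemma Syl.conj {p : ℕ} (hp : p.Prime) {P X Q : Subgroup G} (h : Syl p P X) (hQ : IsPGroup p Q)
    (hQX : Q ≤ X) : ∃ x ∈ X, cj x Q ≤ P := by
  haveI : Fact p.Prime := ⟨hp⟩
  let P' : Sylow p X := IsPGroup.toSylow (P := P.subgroupOf X)
    (h.pg.comap_subtype) h.nd
  obtain ⟨Q', hQ'⟩ := IsPGroup.exists_le_sylow (hQ.comap_subtype (K := X))
  obtain ⟨x, hx⟩ := MulAction.exists_smul_eq X Q' P'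
  refine ⟨x, x.2, ?_⟩
  intro y hy
  rw [mem_cj] at hy
  have hyX : y ∈ X := by
    have := X.mul_mem (X.mul_mem x.2 (hQX hy)) (X.inv_mem x.2)
    simpa [mul_assoc] using this
  have h1 : (x⁻¹ * ⟨y, hyX⟩ * x : X) ∈ (Q' : Subgroup X) := hQ' (by
    rw [Subgroup.mem_comap]; simpa using hy)
  have h2 : (⟨y, hyX⟩ : X) ∈ ((x • Q' : Sylow p X) : Subgroup X) := by
    rw [Sylow.coe_subgroup_smul]
    refine ⟨_, h1, ?_⟩
    simp [mul_assoc]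
  rw [hx] at h2
  have : (⟨y, hyX⟩ : X) ∈ P.subgroupOf X := h2
  simpa [Subgroup.mem_subgroupOf] using this

lemma exists_syl {p : ℕ} (hp : p.Prime) {X Q : Subgroup G} (hQ : IsPGroup p Q)
    (hQX : Q ≤ X) : ∃ P, Syl p P X ∧ Q ≤ P := by
  haveI : Fact p.Prime := ⟨hp⟩
  obtain ⟨Q', hQ'⟩ := IsPGroup.exists_le_sylow (hQ.comap_subtype (K := X))
  refine ⟨(Q' : Subgroup X).map X.subtype, ⟨?_, ?_, ?_⟩, ?_⟩
  · exact Subgroup.map_subtype_le _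
  · exact Q'.isPGroup'.map _
  · have := Q'.not_dvd_index
    rwa [Subgroup.relIndex, Subgroup.subgroupOf, Subgroup.comap_map_eq_self_of_injective
      X.subtype_injective]
  · intro y hy
    exact ⟨⟨y, hQX hy⟩, hQ' (by rw [Subgroup.mem_comap]; simpa using hy), rfl⟩

lemma Syl.le_of_normal {p : ℕ} (hp : p.Prime) {P X Q : Subgroup G} (h : Syl p P X)
    (hQ : IsPGroup p Q) (hQX : Q ≤ X) (hn : X ≤ normalizer (Q : Set G)) : Q ≤ P := by
  obtain ⟨x, hx, hxQ⟩ := h.conj hp hQ hQX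
  rwa [mem_nz_cj.1 (hn hx)] at hxQ

lemma Syl.of_le {p : ℕ} {P X Y : Subgroup G} (h : Syl p P X)
    (hPY : P ≤ Y) (hYX : Y ≤ X) : Syl p P Y := by
  refine ⟨hPY, h.pg, fun hd => h.nd ?_⟩
  rw [← Subgroup.relIndex_mul_relIndex _ _ _ hPY hYX]
  exact Dvd.dvd.mul_right hd _

/-- Frattini -/
lemma Syl.frattini {p : ℕ} (hp : p.Prime) {P N : Subgroup G} (h : Syl p P N) {g : G}
    (hg : g ∈ normalizer (N : Set G)) : ∃ n ∈ N, n * g ∈ normalizer (P : Set G) := by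
  obtain ⟨n, hn, hnP⟩ := h.conj hp (pg_cj h.pg g) (Q := cj g P) (by
    have := cj_mono g h.le
    rwa [mem_nz_cj.1 hg] at this)
  exact ⟨n, hn, nz_of_cj_le (by rwa [cj_mul])⟩

lemma Syl.conjSyl {p : ℕ} (hp : p.Prime) {P X C : Subgroup G} (h : Syl p P X) (hPC : P ≤ C)
    (hCX : C ≤ X) {g : G} (hg : cj g P ≤ C) : ∃ c ∈ C, c * g ∈ normalizer (P : Set G) := by
  obtain ⟨n, hn, hnP⟩ := (h.of_le hPC hCX).conj hp (pg_cj h.pg g) hg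
  exact ⟨n, hn, nz_of_cj_le (by rwa [cj_mul])⟩

lemma Syl.dvd_card {p : ℕ} (hp : p.Prime) {P X : Subgroup G} (h : Syl p P X)
    (hd : p ∣ Nat.card X) : P ≠ ⊥ := by
  rintro rfl
  apply h.nd
  simpa using hd

lemma card_pow {p : ℕ} (hp : p.Prime) {P : Subgroup G} (h : IsPGroup p P) :
    ∃ n, Nat.card P = p ^ n := by
  haveI : Fact p.Prime := ⟨hp⟩
  exact IsPGroup.iff_card.1 h

/-- prime order element -/
lemma exists_prime_order {X : Subgroup G} {p : ℕ} (hp : p.Prime) (h : p ∣ Nat.card X) :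
    ∃ x ∈ X, orderOf x = p := by
  haveI : Fact p.Prime := ⟨hp⟩
  obtain ⟨x, hx⟩ := exists_prime_orderOf_dvd_card' p h
  exact ⟨x, x.2, by simpa using hx⟩

lemma pg_dvd {p : ℕ} (hp : p.Prime) {P : Subgroup G} (h : IsPGroup p P) (hb : P ≠ ⊥) :
    p ∣ Nat.card P := by
  haveI : Fact p.Prime := ⟨hp⟩
  rcases h.card_eq_or_dvd with h | h
  · exact absurd ((Subgroup.card_eq_one).1 h) hb
  · exact h

/-! products -/
lemma card_inj {A B H : Subgroup G} (hd : A ⊓ B = ⊥)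
    (hA : A ≤ H) (hB : B ≤ H) (hf : ∀ h ∈ H, ∃ a ∈ A, ∃ b ∈ B, h = a * b) :
    Nat.card H = Nat.card A * Nat.card B := by
  rw [← Nat.card_prod]
  symm
  apply Nat.card_congr
  refine Equiv.ofBijective (fun x : A × B => (⟨x.1 * x.2, H.mul_mem (hA x.1.2) (hB x.2.2)⟩ : H)) ⟨?_, ?_⟩
  · rintro ⟨a, b⟩ ⟨a', b'⟩ h
    have h : (a : G) * b = a' * b' := by simpa using h
    have h1 : (a' : G)⁻¹ * a = b' * (b : G)⁻¹ := by
      rw [eq_mul_inv_iff_mul_eq, mul_assoc, h]; simp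
    have h2 : (a' : G)⁻¹ * a ∈ A ⊓ B :=
      ⟨A.mul_mem (A.inv_mem a'.2) a.2, h1 ▸ B.mul_mem b'.2 (B.inv_mem b.2)⟩
    rw [hd, Subgroup.mem_bot] at h2
    have h3 : (a : G) = a' := (inv_mul_eq_one.1 h2).symm
    have h4 : (b : G) = b' := by rw [h3] at h; exact mul_left_cancel h
    exact Prod.ext (Subtype.ext h3) (Subtype.ext h4)
  · rintro ⟨h, hh⟩
    obtain ⟨a, ha, b, hb, rfl⟩ := hf h hh
    exact ⟨(⟨a, ha⟩, ⟨b, hb⟩), rfl⟩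

lemma card_sup_dvd {A N : Subgroup G} (hn : A ≤ normalizer (N : Set G)) :
    Nat.card (A ⊔ N : Subgroup G) ∣ Nat.card A * Nat.card N := by
  have h1 : A ⊔ N ≤ normalizer (N : Set G) := sup_le hn le_normalizer
  have h2 : N.relIndex (A ⊔ N) ∣ Nat.card A := by
    have := Subgroup.relIndex_sup_right (A.subgroupOf (normalizer (N : Set G)))
      (N.subgroupOf (normalizer (N : Set G)))
    rw [← Subgroup.subgroupOf_sup hn le_normalizer] at this
    rw [Subgroup.relIndex_subgroupOf h1, Subgroup.relIndex_subgroupOf hn] at this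
    rw [this]
    exact Subgroup.relIndex_dvd_card _ _
  rw [← Subgroup.card_mul_index (N.subgroupOf (A ⊔ N)), mul_comm]
  apply mul_dvd_mul h2
  rw [Nat.card_congr (Subgroup.subgroupOfEquivOfLe (le_sup_right : N ≤ A ⊔ N)).toEquiv]

lemma le_of_coprime_nz {A H N : Subgroup G} {m : ℕ} (hA : A ≤ H) (hNH : N ≤ H)
    (hc : Nat.card H = Nat.card A * m) (hcop : Nat.Coprime (Nat.card A) m)
    (hcN : Nat.Coprime (Nat.card N) m) (hn : A ≤ normalizer (N : Set G)) : N ≤ A := by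
  have h1 := card_sup_dvd hn
  have h2 : Nat.card (A ⊔ N : Subgroup G) ∣ Nat.card A * m := by
    rw [← hc]; exact Subgroup.card_dvd_of_le (sup_le hA hNH)
  have h3 : Nat.card (A ⊔ N : Subgroup G) ∣ Nat.card A :=
    Nat.Coprime.dvd_of_dvd_mul_right
      (Nat.Coprime.coprime_dvd_left h1 (Nat.Coprime.mul_left hcop hcN)) h2
  have h4 : A = A ⊔ N := Subgroup.eq_of_le_of_card_ge le_sup_left (Nat.le_of_dvd Nat.card_pos h3)
  rw [h4]; exact le_sup_right

lemma cop_inf {A B : Subgroup G} (h : Nat.Coprime (Nat.card A) (Nat.card B)) : A ⊓ B = ⊥ :=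
  (Subgroup.disjoint_of_coprime_natCard h).eq_bot

lemma card_lt {P Q : Subgroup G} (h : P < Q) : Nat.card P < Nat.card Q := by
  by_contra hc
  exact h.ne (Subgroup.eq_of_le_of_card_ge h.le (not_lt.1 hc))

end gen
end KW

set_option linter.all false
namespace KW
open Subgroup
open scoped commutatorElement

section nil
variable {G : Type*} [Group G] [Finite G]

lemma nil_of_le {A D : Subgroup G} (hA : Group.IsNilpotent A) (h : D ≤ A) : Group.IsNilpotent D := by
  have : Group.IsNilpotent (D.subgroupOf A) := inferInstance
  exact Group.nilpotent_of_mulEquiv (Subgroup.subgroupOfEquivOfLe h)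

lemma pow_dvd_one {G : Type*} [Group G] {x : G} {m n : ℕ} (h : Nat.Coprime m n) (h1 : x ^ m = 1)
    (h2 : x ^ n = 1) : x = 1 := by
  have : orderOf x ∣ Nat.gcd m n := Nat.dvd_gcd (orderOf_dvd_of_pow_eq_one h1) (orderOf_dvd_of_pow_eq_one h2)
  rw [h, Nat.dvd_one, orderOf_eq_one_iff] at this
  exact this

lemma comm_cop_aux {A : Type*} [Group A] [Finite A] (hA : Group.IsNilpotent A) {a b : A} {m n : ℕ}
    (h : Nat.Coprime m n) (h1 : a ^ m = 1) (h2 : b ^ n = 1) : a * b = b * a := by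
  obtain ⟨e⟩ := (Group.isNilpotent_of_finite_tfae (G := A)).out 0 4 rfl rfl |>.1 hA
  apply e.symm.injective
  rw [map_mul, map_mul]
  ext p P
  have hp : Nat.Prime (p : ℕ) := Nat.prime_of_mem_primeFactors p.2
  have : Fact (Nat.Prime (p : ℕ)) := ⟨hp⟩
  have ha : (e.symm a p P) ^ m = 1 := by
    have := congrArg (fun f => f p P) (congrArg e.symm h1)
    simpa using this
  have hb : (e.symm b p P) ^ n = 1 := by
    have := congrArg (fun f => f p P) (congrArg e.symm h2)
    simpa using this
  suffices e.symm a p P * e.symm b p P = e.symm b p P * e.symm a p P by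
    exact congrArg Subtype.val this
  obtain ⟨k, hk⟩ := P.isPGroup' (e.symm a p P)
  obtain ⟨l, hl⟩ := P.isPGroup' (e.symm b p P)
  by_cases hpm : (p : ℕ) ∣ m
  · have : ¬ (p : ℕ) ∣ n := fun hpn => hp.one_lt.ne' (Nat.dvd_one.1 (h ▸ Nat.dvd_gcd hpm hpn))
    have hc : Nat.Coprime ((p : ℕ) ^ l) n := Nat.Coprime.pow_left _ ((hp.coprime_iff_not_dvd).2 this)
    rw [pow_dvd_one hc hl hb]; simp
  · have hc : Nat.Coprime ((p : ℕ) ^ k) m := Nat.Coprime.pow_left _ ((hp.coprime_iff_not_dvd).2 hpm)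
    rw [pow_dvd_one hc hk ha]; simp

lemma comm_cop {A : Subgroup G} (hA : Group.IsNilpotent A) {a b : G} (ha : a ∈ A) (hb : b ∈ A)
    {m n : ℕ} (h : Nat.Coprime m n) (h1 : a ^ m = 1) (h2 : b ^ n = 1) : a * b = b * a := by
  have := comm_cop_aux hA (a := ⟨a, ha⟩) (b := ⟨b, hb⟩) h (by simpa [Subtype.ext_iff] using h1)
    (by simpa [Subtype.ext_iff] using h2)
  simpa [Subtype.ext_iff] using this

/-- subgroup generated by the `p`-elements of `A` -/
def pp (A : Subgroup G) (p : ℕ) : Subgroup G := closure {g | g ∈ A ∧ ∃ k, g ^ p ^ k = 1}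

lemma pp_le (A : Subgroup G) (p : ℕ) : pp A p ≤ A := by
  rw [pp, closure_le]; exact fun g hg => hg.1

lemma mem_pp' {A : Subgroup G} {p : ℕ} {g : G} (h : g ∈ A) (h' : ∃ k, g ^ p ^ k = 1) : g ∈ pp A p :=
  subset_closure ⟨h, h'⟩

lemma pp_syl {A : Subgroup G} (hA : Group.IsNilpotent A) {p : ℕ} (hp : p.Prime) :
    Syl p (pp A p) A := by
  have : Fact p.Prime := ⟨hp⟩
  obtain ⟨P, hP, -⟩ := exists_syl hp (X := A) (Q := ⊥) (IsPGroup.of_bot) bot_le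
  suffices pp A p = P by rw [this]; exact hP
  apply le_antisymm
  · rw [pp, closure_le]
    rintro g ⟨hg, hk⟩
    have hz : zpowers g ≤ A := by simpa using hg
    -- P normal in A
    have hn : (P.subgroupOf A).Normal := by
      let P' : Sylow p A := IsPGroup.toSylow (P := P.subgroupOf A) (hP.pg.comap_subtype) hP.nd
      have : (P' : Subgroup A).Normal := inferInstance
      exact this
    obtain ⟨x, hx, hxg⟩ := hP.conj hp (pg_zpowers hk) hz
    have h1 : x * g * x⁻¹ ∈ P := hxg (conj_mem_cj (mem_zpowers g))
    have h2 := hn.conj_mem ⟨x * g * x⁻¹, hP.le h1⟩ (by simpa [mem_subgroupOf] using h1) ⟨x, hx⟩⁻¹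
    simpa [mem_subgroupOf, mul_assoc] using h2
  · intro x hx
    exact mem_pp' (hP.le hx) (pg_mem hP.pg hx)

lemma pp_pg {A : Subgroup G} (hA : Group.IsNilpotent A) {p : ℕ} (hp : p.Prime) :
    IsPGroup p (pp A p) := (pp_syl hA hp).pg

lemma mem_pp {A : Subgroup G} (hA : Group.IsNilpotent A) {p : ℕ} (hp : p.Prime) {g : G} :
    g ∈ pp A p ↔ g ∈ A ∧ ∃ k, g ^ p ^ k = 1 :=
  ⟨fun h => ⟨pp_le _ _ h, pg_mem (pp_pg hA hp) h⟩, fun h => mem_pp' h.1 h.2⟩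

lemma pp_nz (A : Subgroup G) (p : ℕ) : normalizer (A : Set G) ≤ normalizer (pp A p : Set G) := by
  intro g hg
  apply nz_of_cj_le
  rw [cj, pp, MonoidHom.map_closure, closure_le]
  rintro _ ⟨x, ⟨hx, k, hk⟩, rfl⟩
  apply Subgroup.subset_closure
  refine ⟨by simpa using nz_conj hg hx, k, ?_⟩
  rw [← map_pow, hk, map_one]

lemma pp_nz' (A : Subgroup G) (p : ℕ) : A ≤ normalizer (pp A p : Set G) :=
  le_normalizer.trans (pp_nz A p)

lemma pp_mono {A D : Subgroup G} (h : D ≤ A) (p : ℕ) : pp D p ≤ pp A p :=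
  closure_mono fun g hg => ⟨h hg.1, hg.2⟩

lemma pp_ne_bot {A : Subgroup G} (hA : Group.IsNilpotent A) {p : ℕ} (hp : p.Prime)
    (hd : p ∣ Nat.card A) : pp A p ≠ ⊥ := (pp_syl hA hp).dvd_card hp hd

lemma dvd_of_pp_ne {A : Subgroup G} (hA : Group.IsNilpotent A) {p : ℕ} (hp : p.Prime)
    (h : pp A p ≠ ⊥) : p ∣ Nat.card A :=
  (pg_dvd hp (pp_pg hA hp) h).trans (card_dvd_of_le (pp_le A p))

lemma pp_comm {A : Subgroup G} (hA : Group.IsNilpotent A) {p r : ℕ} (hp : p.Prime) (hr : r.Prime)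
    (hpr : p ≠ r) {x y : G} (hx : x ∈ pp A p) (hy : y ∈ pp A r) : x * y = y * x := by
  obtain ⟨hx1, k, hk⟩ := (mem_pp hA hp).1 hx
  obtain ⟨hy1, l, hl⟩ := (mem_pp hA hr).1 hy
  exact comm_cop hA hx1 hy1 (Nat.Coprime.pow _ _ ((Nat.coprime_primes hp hr).2 hpr)) hk hl

lemma pp_decomp {A : Subgroup G} (hA : Group.IsNilpotent A) {p : ℕ} (hp : p.Prime) {a : G}
    (ha : a ∈ A) : ∃ u ∈ pp A p, ∃ v ∈ A, a = u * v ∧ (∀ x ∈ pp A p, v * x = x * v) ∧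
      ∃ n, ¬ p ∣ n ∧ v ^ n = 1 := by
  obtain ⟨k, m, hm, hkm⟩ := Nat.exists_eq_pow_mul_and_not_dvd (orderOf_pos a).ne' p hp.ne_one
  have hc : Nat.Coprime m (p ^ k) := ((hp.coprime_iff_not_dvd).2 hm).symm.pow_right k
  obtain ⟨s, t, hst⟩ : ∃ s t : ℤ, s * m + t * (p ^ k : ℕ) = 1 :=
    Nat.isCoprime_iff_coprime.2 hc
  have ho : a ^ (p ^ k * m) = 1 := by rw [← hkm]; exact pow_orderOf_eq_one a
  have hv : (a ^ (t * (p ^ k : ℕ))) ^ m = 1 := by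
    rw [← zpow_natCast, ← zpow_mul, mul_assoc, mul_comm, zpow_mul, ← Nat.cast_mul, zpow_natCast, ho,
      one_zpow]
  have hu : (a ^ (s * m)) ^ (p ^ k) = 1 := by
    rw [← zpow_natCast, ← zpow_mul, mul_assoc, mul_comm, zpow_mul, ← Nat.cast_mul, zpow_natCast,
      mul_comm m, ho, one_zpow]
  have hvA : a ^ (t * (p ^ k : ℕ)) ∈ A := A.zpow_mem ha _
  refine ⟨a ^ (s * m), mem_pp' (A.zpow_mem ha _) ⟨k, hu⟩, _, hvA, ?_, ?_, m, hm, hv⟩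
  · rw [← zpow_add, hst, zpow_one]
  · intro x hx
    obtain ⟨hx1, l, hl⟩ := (mem_pp hA hp).1 hx
    exact comm_cop hA hvA hx1 (((hp.coprime_iff_not_dvd).2 hm).symm.pow_right l) hv hl

lemma card_dvd_of_syl {X : Subgroup G} {n : ℕ} (hn : n ≠ 0)
    (h : ∀ p, p.Prime → p ∣ Nat.card X → ∃ P, Syl p P X ∧ Nat.card P ∣ n) : Nat.card X ∣ n := by
  rw [Nat.dvd_iff_prime_pow_dvd_dvd]
  intro p k hp hd
  rcases Nat.eq_zero_or_pos k with rfl | hk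
  · simp
  obtain ⟨P, hP, hPn⟩ := h p hp ((dvd_pow_self p hk.ne').trans hd)
  refine dvd_trans ?_ hPn
  have := Subgroup.card_mul_index (P.subgroupOf X)
  rw [Nat.card_congr (Subgroup.subgroupOfEquivOfLe hP.le).toEquiv] at this
  rw [← this] at hd
  exact Nat.Coprime.dvd_of_dvd_mul_right
    (Nat.Coprime.pow_left _ ((hp.coprime_iff_not_dvd).2 hP.nd)) hd

lemma le_of_pp {A H : Subgroup G} (hA : Group.IsNilpotent A)
    (h : ∀ p, p.Prime → p ∣ Nat.card A → pp A p ≤ H) : A ≤ H := by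
  have h1 : Nat.card A ∣ Nat.card (A ⊓ H : Subgroup G) :=
    card_dvd_of_syl Nat.card_pos.ne' fun p hp hd =>
      ⟨_, pp_syl hA hp, card_dvd_of_le (le_inf (pp_le A p) (h p hp hd))⟩
  have : A ⊓ H = A := Subgroup.eq_of_le_of_card_ge inf_le_left (Nat.le_of_dvd Nat.card_pos h1)
  exact inf_eq_left.1 this

lemma exists_central_aux {A : Type*} [Group A] (hA : Group.IsNilpotent A) {N : Subgroup A} [N.Normal]
    (hN : N ≠ ⊥) : ∃ x ∈ N, x ≠ 1 ∧ ∀ a, a * x = x * a := by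
  classical
  obtain ⟨n, hn⟩ := hA.nilpotent
  have hex : ∃ n, N ⊓ Subgroup.upperCentralSeries A n ≠ ⊥ := ⟨n, by rw [hn]; simpa using hN⟩
  have h0 : Nat.find hex ≠ 0 := by
    intro h
    have := Nat.find_spec hex
    rw [h] at this
    simp at this
  obtain ⟨m, hm⟩ := Nat.exists_eq_succ_of_ne_zero h0
  have h1 := Nat.find_spec hex
  have h2 : N ⊓ Subgroup.upperCentralSeries A m = ⊥ := by
    have := Nat.find_min hex (m := m) (by omega)
    simpa using this
  rw [hm] at h1
  obtain ⟨⟨x, hx⟩, hx1⟩ := (Subgroup.ne_bot_iff_exists_ne_one).1 h1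
  refine ⟨x, hx.1, by simpa [Subtype.ext_iff] using hx1, fun a => ?_⟩
  have h3 := Subgroup.mem_upperCentralSeries_succ_iff.1 hx.2 a
  have h4 : ⁅(x : A), a⁆ ∈ N := by
    rw [commutatorElement_def, mul_assoc, mul_assoc]
    apply N.mul_mem hx.1
    have := (inferInstance : N.Normal).conj_mem _ (N.inv_mem hx.1) a
    simpa [mul_assoc] using this
  have h5 : ⁅(x : A), a⁆ ∈ N ⊓ Subgroup.upperCentralSeries A m := ⟨h4, h3⟩
  rw [h2, mem_bot, commutatorElement_eq_one_iff_mul_comm] at h5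
  exact h5.symm

lemma exists_central {A : Subgroup G} (hA : Group.IsNilpotent A) {N : Subgroup G} (hNA : N ≤ A)
    (hn : A ≤ normalizer (N : Set G)) (hN : N ≠ ⊥) :
    ∃ x ∈ N, x ≠ 1 ∧ ∀ a ∈ A, a * x = x * a := by
  have : (N.subgroupOf A).Normal := by
    constructor
    rintro ⟨n, hnA⟩ h ⟨g, hg⟩
    rw [mem_subgroupOf] at h ⊢
    exact nz_conj (hn hg) h
  obtain ⟨x, hx, hx1, hc⟩ := exists_central_aux hA (N := N.subgroupOf A) (by
    intro h
    apply hN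
    rw [Subgroup.subgroupOf_eq_bot] at h
    exact (disjoint_self.1 (h.mono_right hNA)))
  refine ⟨x, hx, fun h => hx1 (Subtype.ext h), fun a ha => ?_⟩
  exact congrArg Subtype.val (hc ⟨a, ha⟩)

lemma exists_central_pp {A : Subgroup G} (hA : Group.IsNilpotent A) {p : ℕ} (hp : p.Prime)
    (hd : p ∣ Nat.card A) :
    ∃ x ∈ pp A p, x ≠ 1 ∧ ∀ a ∈ A, a * x = x * a :=
  exists_central hA (pp_le A p) (pp_nz' A p) (pp_ne_bot hA hp hd)

/-- normalizers grow in `p`-groups -/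
lemma nz_grow {p : ℕ} (hp : p.Prime) {P Q : Subgroup G} (hP : IsPGroup p P) (hQ : Q < P) :
    ∃ x ∈ P, x ∉ Q ∧ x ∈ normalizer (Q : Set G) := by
  have : Fact p.Prime := ⟨hp⟩
  have hn : Group.IsNilpotent P := hP.isNilpotent
  have h1 := Group.normalizerCondition_of_isNilpotent (G := P) (Q.subgroupOf P) (by
    rw [lt_top_iff_ne_top, Ne, Subgroup.subgroupOf_eq_top]
    exact not_le_of_gt hQ)
  obtain ⟨x, hx, hxQ⟩ := SetLike.exists_of_lt h1
  refine ⟨x, x.2, fun h => hxQ (by simpa [mem_subgroupOf] using h), mem_nz fun y hy => ?_⟩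
  have := nz_conj hx (x := ⟨y, hQ.le hy⟩) (by simpa [mem_subgroupOf] using hy)
  simpa [mem_subgroupOf] using this

end nil
end KW

set_option linter.all false
namespace KW
open Subgroup
open scoped commutatorElement

section solv
variable {G : Type*} [Group G] [Finite G]

lemma normal_of_top_le {N : Subgroup G} (h : ∀ g : G, g ∈ normalizer (N : Set G)) : N.Normal :=
  ⟨fun n hn g => nz_conj (h g) hn⟩

lemma nz_of_normal {N : Subgroup G} (h : N.Normal) (g : G) : g ∈ normalizer (N : Set G) :=
  mem_nz fun x hx => h.conj_mem x hx g

lemma pp_normal {N : Subgroup G} (h : N.Normal) (p : ℕ) : (pp N p).Normal :=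
  normal_of_top_le fun g => pp_nz N p (nz_of_normal h g)

/-- elements centralizing all normal nilpotent subgroups -/
def CF (G : Type*) [Group G] : Subgroup G :=
  centralizer {w : G | ∃ W : Subgroup G, W.Normal ∧ Group.IsNilpotent W ∧ w ∈ W}

lemma CF_normal : (CF G).Normal := by
  constructor
  intro c hc g
  rw [CF, mem_centralizer_iff] at hc ⊢
  rintro w ⟨W, hW, hWn, hw⟩
  have := hc (g⁻¹ * w * g) ⟨W, hW, hWn, by simpa using hW.conj_mem w hw g⁻¹⟩
  have h2 := congrArg (fun x => g * x * g⁻¹) this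
  simpa [mul_assoc] using h2

lemma nil_of_le_CF (hs : Group.IsSolvable G) : ∀ (n : ℕ) (K : Subgroup G), Nat.card K = n →
    K.Normal → K ≤ CF G → Group.IsNilpotent K := by
  intro n
  induction n using Nat.strong_induction_on with
  | _ n ih =>
    intro K hK hn hC
    by_cases hb : K = ⊥
    · subst hb; infer_instance
    have hlt : ⁅K, K⁆ < K := Group.IsSolvable.commutator_lt_of_ne_bot hb
    have hn' : (⁅K, K⁆ : Subgroup G).Normal := inferInstance
    have h1 := ih _ (by rw [← hK]; exact card_lt hlt) ⁅K, K⁆ rfl hn' (hlt.le.trans hC)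
    rw [isNilpotent_iff_lowerCentralSeries]
    refine ⟨2, ?_⟩
    change ⁅⁅K, K⁆, K⁆ = ⊥
    rw [eq_bot_iff, Subgroup.commutator_le]
    intro a ha b hb
    rw [mem_bot, commutatorElement_eq_one_iff_mul_comm]
    exact mem_centralizer_iff.1 (hC hb) a ⟨_, hn', h1, ha⟩

lemma CF_nil (hs : Group.IsSolvable G) : Group.IsNilpotent (CF G) :=
  nil_of_le_CF hs _ _ rfl CF_normal le_rfl

lemma L00 {T S : Subgroup G} (hs : Group.IsSolvable G) (hT : Group.IsNilpotent T)
    (hf : ∀ g : G, ∃ t ∈ T, ∃ s ∈ S, g = t * s)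
    (hc : Nat.Coprime (Nat.card T) (Nat.card S)) {p : ℕ} (hp : p.Prime) {z : G} (hz : z ∈ T)
    (hzc : ∀ t ∈ T, t * z = z * t) (hzp : ∃ k, z ^ p ^ k = 1)
    (h : ∀ l, l.Prime → ∀ W : Subgroup G, W.Normal → IsPGroup l W → W ≤ S → W = ⊥) :
    ∃ L : Subgroup G, L.Normal ∧ IsPGroup p L ∧ z ∈ L := by
  have hcard : Nat.card (⊤ : Subgroup G) = Nat.card T * Nat.card S :=
    card_inj (cop_inf hc) le_top le_top fun g _ => hf g
  have hzC : z ∈ CF G := by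
    rw [CF, mem_centralizer_iff]
    rintro w ⟨W, hW, hWn, hw⟩
    suffices W ≤ centralizer {z} by
      exact (mem_centralizer_iff.1 (this hw) z rfl).symm
    apply le_of_pp hWn
    intro l hl hd
    have hpn := pp_normal hW l
    have hpg := pp_pg hWn hl
    obtain ⟨n, hn⟩ := card_pow hl hpg
    by_cases hlS : l ∣ Nat.card S
    · have hle : pp W l ≤ S := by
        apply le_of_coprime_nz (H := ⊤) (m := Nat.card T) le_top le_top (by rw [hcard, mul_comm])
          hc.symm _ fun g _ => nz_of_normal hpn g
        rw [hn]
        apply Nat.Coprime.pow_left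
        rw [hl.coprime_iff_not_dvd]
        intro hlT
        exact hl.one_lt.ne' (Nat.dvd_one.1 (hc ▸ Nat.dvd_gcd hlT hlS))
      rw [h l hl _ hpn hpg hle]; exact bot_le
    · have hle : pp W l ≤ T := by
        apply le_of_coprime_nz (H := ⊤) (m := Nat.card S) le_top le_top hcard
          hc _ fun g _ => nz_of_normal hpn g
        rw [hn]
        apply Nat.Coprime.pow_left
        rwa [hl.coprime_iff_not_dvd]
      intro x hx
      rw [mem_centralizer_iff]
      rintro _ rfl
      exact (hzc x (hle hx)).symm
  exact ⟨pp (CF G) p, pp_normal CF_normal p, pp_pg (CF_nil hs) hp, mem_pp' hzC hzp⟩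

lemma nil_map {K : Type*} [Group K] {T : Subgroup G} (hT : Group.IsNilpotent T) (f : G →* K) :
    Group.IsNilpotent (T.map f) :=
  Group.nilpotent_of_surjective (f.subgroupMap T) (f.subgroupMap_surjective T)

lemma exists_Oq (q : ℕ) : ∃ M : Subgroup G, M.Normal ∧ IsPGroup q M ∧
    ∀ W : Subgroup G, W.Normal → IsPGroup q W → W ≤ M := by
  obtain ⟨M, ⟨hM1, hM2⟩, hmax⟩ := (Set.toFinite {W : Subgroup G | W.Normal ∧ IsPGroup q W}).exists_maximal
    ⟨⊥, inferInstance, IsPGroup.of_bot⟩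
  refine ⟨M, hM1, hM2, fun W hW hWq => ?_⟩
  have h1 : (W ⊔ M : Subgroup G) ∈ {W : Subgroup G | W.Normal ∧ IsPGroup q W} :=
    ⟨inferInstance, hWq.to_sup_of_normal_right hM2⟩
  exact le_sup_left.trans (hmax h1 le_sup_right)

lemma L0 {T S : Subgroup G} (hs : Group.IsSolvable G) (hT : Group.IsNilpotent T)
    (hS : Group.IsNilpotent S)
    (hf : ∀ g : G, ∃ t ∈ T, ∃ s ∈ S, g = t * s)
    (hc : Nat.Coprime (Nat.card T) (Nat.card S)) {p q : ℕ} (hp : p.Prime) (hq : q.Prime)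
    (hqT : ¬ q ∣ Nat.card T) {z : G} (hz : z ∈ T)
    (hzc : ∀ t ∈ T, t * z = z * t) (hzp : ∃ k, z ^ p ^ k = 1)
    (h : ∀ l, l.Prime → l ≠ q → ∀ W : Subgroup G, W.Normal → IsPGroup l W → W ≤ S → W = ⊥) :
    ∃ M L : Subgroup G, M.Normal ∧ L.Normal ∧ M ≤ L ∧ IsPGroup q M ∧ z ∈ L ∧
      ∀ x ∈ L, ∃ k, x ^ p ^ k ∈ M := by
  have hcard : Nat.card (⊤ : Subgroup G) = Nat.card T * Nat.card S :=
    card_inj (cop_inf hc) le_top le_top fun g _ => hf g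
  obtain ⟨M, hM, hMq, hmax⟩ := exists_Oq (G := G) q
  have hMS : M ≤ S := by
    apply le_of_coprime_nz (H := ⊤) (m := Nat.card T) le_top le_top (by rw [hcard, mul_comm])
      hc.symm _ fun g _ => nz_of_normal hM g
    obtain ⟨n, hn⟩ := card_pow hq hMq
    rw [hn]
    apply Nat.Coprime.pow_left
    rwa [hq.coprime_iff_not_dvd]
  let f := QuotientGroup.mk' M
  have hfs : Function.Surjective f := QuotientGroup.mk'_surjective M
  have hker : f.ker = M := QuotientGroup.ker_mk' M
  obtain ⟨L, hL, hLp, hzL⟩ := L00 (G := G ⧸ M) (T := T.map f) (S := S.map f) inferInstance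
    (nil_map hT f) (by
      intro g
      obtain ⟨g, rfl⟩ := hfs g
      obtain ⟨t, ht, s, hs, rfl⟩ := hf g
      exact ⟨f t, mem_map_of_mem f ht, f s, mem_map_of_mem f hs, map_mul f t s⟩)
    (Nat.Coprime.coprime_dvd_left (card_map_dvd T f)
      (Nat.Coprime.coprime_dvd_right (card_map_dvd S f) hc)) hp (z := f z) (mem_map_of_mem f hz)
    (by
      rintro _ ⟨t, ht, rfl⟩
      rw [← map_mul, ← map_mul, hzc t ht])
    (by
      obtain ⟨k, hk⟩ := hzp
      exact ⟨k, by rw [← map_pow, hk, map_one]⟩)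
    (by
      intro l hl W hW hWl hWS
      have hWn : (W.comap f).Normal := hW.comap f
      have hWm : (W.comap f).map f = W := map_comap_eq_self_of_surjective hfs W
      by_cases hlq : l = q
      · subst hlq
        have h1 : IsPGroup l (W.comap f) := hWl.comap_of_ker_isPGroup f (by rw [hker]; exact hMq)
        have h2 := hmax _ hWn h1
        rw [← hWm, eq_bot_iff, map_le_iff_le_comap]
        intro x hx
        have : x ∈ f.ker := by rw [hker]; exact h2 hx
        rw [mem_comap, this]; exact one_mem _
      · have h1 : W.comap f ≤ S := by
          intro x hx
          obtain ⟨s, hs, hsx⟩ := hWS hx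
          have : s⁻¹ * x ∈ f.ker := by
            rw [MonoidHom.mem_ker, map_mul, map_inv, hsx, inv_mul_cancel]
          rw [hker] at this
          have := S.mul_mem hs (hMS this)
          simpa using this
        have h2 : Group.IsNilpotent (W.comap f) := nil_of_le hS h1
        have h3 := h l hl hlq _ (pp_normal hWn l) (pp_pg h2 hl) ((pp_le _ _).trans h1)
        by_contra hne
        have h4 : l ∣ Nat.card W := pg_dvd hl hWl hne
        have h5 : Nat.card W ∣ Nat.card (W.comap f) := by
          have := card_map_dvd (W.comap f) f
          rwa [hWm] at this
        exact pp_ne_bot h2 hl (h4.trans h5) h3)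
  refine ⟨M, L.comap f, hM, hL.comap f, ?_, hMq, hzL, ?_⟩
  · intro x hx
    have : x ∈ f.ker := by rw [hker]; exact hx
    rw [mem_comap, this]; exact one_mem _
  · intro x hx
    obtain ⟨k, hk⟩ := pg_mem hLp hx
    refine ⟨k, ?_⟩
    rw [← hker, MonoidHom.mem_ker, map_pow, hk]

end solv

section transfer
variable {G : Type*} [Group G] [Finite G]

lemma card_relIndex {P X : Subgroup G} (h : P ≤ X) : Nat.card P * P.relIndex X = Nat.card X := by
  have := Subgroup.card_mul_index (P.subgroupOf X)
  rwa [Nat.card_congr (Subgroup.subgroupOfEquivOfLe h).toEquiv] at this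

lemma Syl.of_card_ge {p : ℕ} (hp : p.Prime) {P Q X : Subgroup G} (hQ : Syl p Q X) (hP : IsPGroup p P)
    (hPX : P ≤ X) (h : Nat.card Q ≤ Nat.card P) : Syl p P X := by
  refine ⟨hPX, hP, fun hd => hQ.nd ?_⟩
  obtain ⟨a, ha⟩ := card_pow hp hP
  obtain ⟨b, hb⟩ := card_pow hp hQ.pg
  have hba : b ≤ a := by
    rw [ha, hb] at h
    exact (Nat.pow_le_pow_iff_right hp.one_lt).1 h
  have h1 := card_relIndex hPX
  rw [← card_relIndex hQ.le, ha, hb, ← Nat.sub_add_cancel hba, pow_add, mul_comm (p ^ (a - b)),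
    mul_assoc] at h1
  have h2 := Nat.eq_of_mul_eq_mul_left (Nat.pow_pos hp.pos) h1
  rw [← h2]
  exact hd.mul_left _

lemma Syl.inf_normal {p : ℕ} (hp : p.Prime) {P N X : Subgroup G} (hP : Syl p P X) (hNX : N ≤ X)
    (hn : X ≤ normalizer (N : Set G)) : Syl p (P ⊓ N) N := by
  obtain ⟨Q, hQ, -⟩ := exists_syl hp (X := N) (Q := ⊥) IsPGroup.of_bot bot_le
  obtain ⟨x, hx, hxQ⟩ := hP.conj hp hQ.pg (hQ.le.trans hNX)
  apply hQ.of_card_ge hp (hP.pg.to_le inf_le_left) inf_le_right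
  rw [← card_cj x Q]
  apply Nat.le_of_dvd Nat.card_pos (card_dvd_of_le _)
  refine le_inf hxQ ?_
  have := cj_mono x hQ.le
  rwa [mem_nz_cj.1 (hn hx)] at this

/-- subgroup generated by the elements of order prime to r of `X` -/
def OO (X : Subgroup G) (r : ℕ) : Subgroup G := closure {x | x ∈ X ∧ ∃ n, ¬ r ∣ n ∧ x ^ n = 1}

lemma OO_le (X : Subgroup G) (r : ℕ) : OO X r ≤ X := by
  rw [OO, closure_le]; exact fun g hg => hg.1

lemma OO_nz (X : Subgroup G) (r : ℕ) : X ≤ normalizer (OO X r : Set G) := by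
  intro g hg
  apply nz_of_cj_le
  rw [cj, OO, MonoidHom.map_closure, closure_le]
  rintro _ ⟨x, ⟨hx, k, hk, hk'⟩, rfl⟩
  apply Subgroup.subset_closure
  refine ⟨by simpa using X.mul_mem (X.mul_mem hg hx) (X.inv_mem hg), k, hk, ?_⟩
  rw [← map_pow, hk', map_one]

lemma eq_bot_of_le_commutator {r : ℕ} (hr : r.Prime) {P Q : Subgroup G} (hP : IsPGroup r P)
    (hQP : Q ≤ P) (h : Q ≤ ⁅Q, P⁆) : Q = ⊥ := by
  have : Fact r.Prime := ⟨hr⟩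
  have hn : Group.IsNilpotent P := hP.isNilpotent
  obtain ⟨n, hn⟩ := (isNilpotent_iff_lowerCentralSeries P).1 hn
  have h1 : ∀ n, Q ≤ P.lowerCentralSeries n := by
    intro n
    induction n with
    | zero => simpa using hQP
    | succ n ih =>
      rw [Subgroup.lowerCentralSeries_succ]
      exact h.trans (commutator_mono ih le_rfl)
  rw [eq_bot_iff, ← hn]
  exact h1 n

lemma transfer_lemma {r : ℕ} (hr : r.Prime) {P X : Subgroup G} (hP : Syl r P X)
    (hfus : ∀ u ∈ P, ∀ g ∈ X, g * u * g⁻¹ ∈ P → ∃ y ∈ P, g * u * g⁻¹ = y * u * y⁻¹) :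
    ¬ r ∣ Nat.card (OO X r) := by
  have : Fact r.Prime := ⟨hr⟩
  set K := OO X r with hK
  have hS : Syl r (P ⊓ K) K := hP.inf_normal hr (OO_le X r) (OO_nz X r)
  let S : Sylow r K := IsPGroup.toSylow (P := (P ⊓ K).subgroupOf K) (hS.pg.comap_subtype) hS.nd
  have hker : ∀ x : K, S.transferFocal x = 1 := by
    have h1 : K ≤ (S.transferFocal.ker).map K.subtype := by
      conv_lhs => rw [hK, OO]
      rw [closure_le]
      rintro x ⟨hx, n, hn, hxn⟩
      have hxK : x ∈ K := Subgroup.subset_closure ⟨hx, n, hn, hxn⟩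
      refine ⟨⟨x, hxK⟩, ?_, rfl⟩
      have hQ : IsPGroup r (S ⧸ S.focalSubgroupOf) := S.2.to_quotient S.focalSubgroupOf
      obtain ⟨k, hk⟩ := hQ (S.transferFocal ⟨x, hxK⟩)
      have h2 : (S.transferFocal ⟨x, hxK⟩) ^ n = 1 := by
        rw [← map_pow]
        have : (⟨x, hxK⟩ : K) ^ n = 1 := Subtype.ext hxn
        rw [this, map_one]
      exact pow_dvd_one (Nat.Coprime.pow_left k ((hr.coprime_iff_not_dvd).2 hn)) hk h2
    intro x
    obtain ⟨y, hy, hyx⟩ := h1 x.2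
    have : y = x := Subtype.ext hyx
    exact this ▸ hy
  have hfoc : (S : Subgroup K) ≤ S.focalSubgroup := by
    rw [← ker_transferFocal_inf_eq_focalSubgroup S]
    exact le_inf (fun x _ => hker x) le_rfl
  have hle : P ⊓ K ≤ ⁅P ⊓ K, P⁆ := by
    intro x hx
    have h1 : (⟨x, hx.2⟩ : K) ∈ S.focalSubgroup := hfoc (by
      change _ ∈ (P ⊓ K).subgroupOf K
      rw [mem_subgroupOf]; exact hx)
    have h2 : S.focalSubgroup ≤ (⁅P ⊓ K, P⁆).comap K.subtype := by
      rw [focalSubgroup_def, closure_le]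
      rintro _ ⟨hg, x, hx, u, rfl⟩
      have hx' : (x : G) ∈ P ⊓ K := hx
      have hg' : ((⁅x, u⁆ : K) : G) ∈ P ⊓ K := hg
      have e1 : ((⁅x, u⁆ : K) : G) = x * ((u : G) * (x : G)⁻¹ * (u : G)⁻¹) := by
        simp [commutatorElement_def, mul_assoc]
      have h3 : (u : G) * (x : G)⁻¹ * (u : G)⁻¹ ∈ P := by
        have := P.mul_mem (P.inv_mem hx'.1) hg'.1
        rw [e1] at this
        simpa using this
      obtain ⟨y, hy, hyx⟩ := hfus (x : G)⁻¹ (P.inv_mem hx'.1) u (OO_le X r u.2) h3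
      change ((⁅x, u⁆ : K) : G) ∈ ⁅P ⊓ K, P⁆
      rw [e1, hyx]
      have := commutator_mem_commutator hx' hy
      rw [commutatorElement_def] at this
      simpa [mul_assoc] using this
    exact h2 h1
  have hb := eq_bot_of_le_commutator hr hP.pg inf_le_left hle
  rw [hb] at hS
  exact fun hd => hS.dvd_card hr hd rfl

end transfer
end KW

set_option linter.all false
namespace KW
open Subgroup
open scoped commutatorElement

section main
variable {G : Type*} [Group G] [Finite G]

/-- `H` is factorised by `A` and `B` -/
def Fz (A B H : Subgroup G) : Prop := ∀ h ∈ H, ∃ a ∈ A, a ∈ H ∧ ∃ b ∈ B, b ∈ H ∧ h = a * b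

lemma Fz.symm {A B H : Subgroup G} (h : Fz A B H) : Fz B A H := by
  intro x hx
  obtain ⟨a, ha, haH, b, hb, hbH, e⟩ := h x⁻¹ (H.inv_mem hx)
  refine ⟨b⁻¹, B.inv_mem hb, H.inv_mem hbH, a⁻¹, A.inv_mem ha, H.inv_mem haH, ?_⟩
  rw [← mul_inv_rev, ← e, inv_inv]

lemma Fz.card {A B H : Subgroup G} (h : Fz A B H) (hd : A ⊓ B = ⊥) :
    Nat.card H = Nat.card (A ⊓ H : Subgroup G) * Nat.card (B ⊓ H : Subgroup G) := by
  apply card_inj _ inf_le_right inf_le_right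
  · intro x hx
    obtain ⟨a, ha, haH, b, hb, hbH, e⟩ := h x hx
    exact ⟨a, ⟨ha, haH⟩, b, ⟨hb, hbH⟩, e⟩
  · rw [eq_bot_iff, ← hd]
    exact inf_le_inf inf_le_left inf_le_left

structure Hyp (A B : Subgroup G) : Prop where
  nA : Group.IsNilpotent A
  nB : Group.IsNilpotent B
  fact : ∀ g : G, ∃ a ∈ A, ∃ b ∈ B, g = a * b
  cop : Nat.Coprime (Nat.card A) (Nat.card B)
  simp : ∀ N : Subgroup G, N.Normal → N = ⊥ ∨ N = ⊤
  nsol : ¬ Group.IsSolvable G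
  sub : ∀ H : Subgroup G, H ≠ ⊤ → Fz A B H → Group.IsSolvable H
  mA : ∀ p, ∃ r, r.Prime ∧ r ≠ p ∧ r ∣ Nat.card A
  mB : ∀ p, ∃ r, r.Prime ∧ r ≠ p ∧ r ∣ Nat.card B

variable {A B : Subgroup G}

lemma Hyp.symm (h : Hyp A B) : Hyp B A where
  nA := h.nB
  nB := h.nA
  fact g := by
    obtain ⟨a, ha, b, hb, e⟩ := h.fact g⁻¹
    refine ⟨b⁻¹, B.inv_mem hb, a⁻¹, A.inv_mem ha, ?_⟩
    rw [← mul_inv_rev, ← e, inv_inv]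
  cop := h.cop.symm
  simp := h.simp
  nsol := h.nsol
  sub H hH hf := h.sub H hH hf.symm
  mA := h.mB
  mB := h.mA

lemma Hyp.inf (h : Hyp A B) : A ⊓ B = ⊥ := cop_inf h.cop

lemma Hyp.one (h : Hyp A B) {x : G} (ha : x ∈ A) (hb : x ∈ B) : x = 1 := by
  have : x ∈ A ⊓ B := ⟨ha, hb⟩
  rwa [h.inf, mem_bot] at this

lemma not_top_of_nil (hG : ¬ Group.IsSolvable G) (hA : Group.IsNilpotent A) : A ≠ ⊤ := by
  rintro rfl
  apply hG
  have := Group.isNilpotent_top.1 hA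
  infer_instance

lemma Hyp.A_ne (h : Hyp A B) : A ≠ ⊤ := not_top_of_nil h.nsol h.nA

lemma Hyp.ne_top (h : Hyp A B) {V : Subgroup G} (hV : V ≤ A) : V ≠ ⊤ :=
  fun e => h.A_ne (top_le_iff.1 (e ▸ hV))

lemma Hyp.nz_ne_top (h : Hyp A B) {V : Subgroup G} (hb : V ≠ ⊥) (ht : V ≠ ⊤) :
    normalizer (V : Set G) ≠ ⊤ := by
  intro e
  have : V.Normal := normal_of_top_le fun g => by rw [e]; trivial
  exact (h.simp V this).elim hb ht

lemma Hyp.fz_of_le (h : Hyp A B) {H : Subgroup G} (hA : A ≤ H) : Fz A B H := by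
  intro x hx
  obtain ⟨a, ha, b, hb, e⟩ := h.fact x
  refine ⟨a, ha, hA ha, b, hb, ?_, e⟩
  have : b = a⁻¹ * x := by rw [e]; group
  rw [this]
  exact H.mul_mem (H.inv_mem (hA ha)) hx

lemma Hyp.F2 (h : Hyp A B) {H Z : Subgroup G} (hA : A ≤ H) (hH : H ≠ ⊤) (hZB : Z ≤ B)
    (hn : B ≤ normalizer (Z : Set G)) (hZ : Z ≤ H) : Z = ⊥ := by
  have h1 : normalClosure (Z : Set G) ≤ H := by
    rw [normalClosure, closure_le]
    intro y hy
    obtain ⟨x, hx, hxy⟩ := Group.mem_conjugatesOfSet_iff.1 hy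
    obtain ⟨g, rfl⟩ := isConj_iff.1 hxy
    obtain ⟨a, ha, b, hb, rfl⟩ := h.fact g
    have := H.mul_mem (H.mul_mem (hA ha) (hZ (nz_conj (hn hb) hx))) (H.inv_mem (hA ha))
    simpa [mul_assoc] using this
  rcases h.simp _ (normalClosure_normal (s := (Z : Set G))) with e | e
  · rw [eq_bot_iff, ← e]; exact subset_normalClosure
  · rw [e, top_le_iff] at h1; exact absurd h1 hH

lemma not_dvd_both (h : Hyp A B) {p : ℕ} (hp : p.Prime) (hA : p ∣ Nat.card A) : ¬ p ∣ Nat.card B :=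
  fun hB => hp.one_lt.ne' (Nat.dvd_one.1 (h.cop ▸ Nat.dvd_gcd hA hB))

lemma Syl.up {p : ℕ} (hp : p.Prime) {P X H : Subgroup G} {m : ℕ} (h : Syl p P X) (hX : X ≤ H)
    (hc : Nat.card H = Nat.card X * m) (hm : ¬ p ∣ m) : Syl p P H := by
  refine ⟨h.le.trans hX, h.pg, fun hd => ?_⟩
  rw [← relIndex_mul_relIndex _ _ _ h.le hX] at hd
  have h1 : X.relIndex H = m := by
    have := card_relIndex hX
    rw [hc] at this
    exact Nat.eq_of_mul_eq_mul_left Nat.card_pos this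
  rcases hp.dvd_mul.1 hd with hd | hd
  · exact h.nd hd
  · exact hm (h1 ▸ hd)

lemma Hyp.cardG (h : Hyp A B) : Nat.card (⊤ : Subgroup G) = Nat.card A * Nat.card B :=
  card_inj h.inf le_top le_top fun g _ => h.fact g

lemma Hyp.syl (h : Hyp A B) {p : ℕ} (hp : p.Prime) (hd : p ∣ Nat.card A) : Syl p (pp A p) ⊤ :=
  (pp_syl h.nA hp).up hp le_top h.cardG (not_dvd_both h hp hd)

lemma Hyp.sylH (h : Hyp A B) {p : ℕ} (hp : p.Prime) (hd : p ∣ Nat.card A) {H : Subgroup G}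
    (hH : Fz A B H) : Syl p (pp (A ⊓ H) p) H :=
  (pp_syl (nil_of_le h.nA inf_le_left) hp).up hp inf_le_right (hH.card h.inf) fun hd' =>
    not_dvd_both h hp hd (hd'.trans (card_dvd_of_le inf_le_left))

lemma Hyp.conjA (h : Hyp A B) {p : ℕ} (hp : p.Prime) (hd : p ∣ Nat.card A) {V : Subgroup G}
    (hV : IsPGroup p V) : ∃ b ∈ B, cj b V ≤ pp A p := by
  obtain ⟨g, -, hg⟩ := (h.syl hp hd).conj hp hV le_top
  obtain ⟨a, ha, b, hb, rfl⟩ := h.fact g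
  refine ⟨b, hb, ?_⟩
  have := cj_mono a⁻¹ hg
  rwa [mem_nz_cj.1 (pp_nz' A p (A.inv_mem ha)), ← cj_mul, inv_mul_cancel_left] at this

lemma nz_le_cent_nz (V : Subgroup G) :
    normalizer (V : Set G) ≤ normalizer ((centralizer (V : Set G) : Subgroup G) : Set G) := by
  intro g hg
  apply mem_nz
  intro c hc
  rw [mem_centralizer_iff] at hc ⊢
  intro v hv
  have := hc (g⁻¹ * v * g) (nz_conj' hg hv)
  have h2 := congrArg (fun x => g * x * g⁻¹) this
  simpa [mul_assoc] using h2

lemma cent_le_nz (V : Subgroup G) : centralizer (V : Set G) ≤ normalizer (V : Set G) := by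
  intro g hg
  apply mem_nz
  intro x hx
  have := mem_centralizer_iff.1 hg x hx
  rw [← this]; simpa using hx

lemma mem_cent_conj {g x : G} : g ∈ centralizer ({x} : Set G) ↔ g * x * g⁻¹ = x := by
  rw [mem_centralizer_singleton_iff, mul_inv_eq_iff_eq_mul]

lemma pp_le_cent {A V : Subgroup G} (hA : Group.IsNilpotent A) {p r : ℕ} (hp : p.Prime)
    (hr : r.Prime) (hpr : r ≠ p) (hV : V ≤ pp A p) : pp A r ≤ centralizer (V : Set G) := by
  intro x hx
  rw [mem_centralizer_iff]
  intro v hv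
  exact pp_comm hA hp hr hpr.symm (hV hv) hx

/-- (2): normalizers of `q`-parts of centralizers in `B` are factorised -/
lemma Hyp.nz_fz (h : Hyp A B) {D E : Subgroup G} {q : ℕ} (hDB : D ≤ B) (hDE : D ≤ E)
    (hDq : IsPGroup q D) (hE : A ≤ normalizer (E : Set G))
    (hmax : ∀ x ∈ B, x ∈ E → (∃ k, x ^ q ^ k = 1) → x ∈ D) : Fz A B (normalizer (D : Set G)) := by
  apply Fz.symm
  intro g hg
  obtain ⟨b, hb, a, ha, rfl⟩ := h.symm.fact g
  have ha' : a ∈ normalizer (D : Set G) := by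
    apply mem_nz
    intro x hx
    have h1 : a * x * a⁻¹ = b⁻¹ * (b * a * x * (b * a)⁻¹) * b := by group
    have h2 := nz_conj hg hx
    apply hmax
    · rw [h1]; exact B.mul_mem (B.mul_mem (B.inv_mem hb) (hDB h2)) hb
    · exact nz_conj (hE ha) (hDE hx)
    · obtain ⟨k, hk⟩ := pg_mem hDq hx
      refine ⟨k, ?_⟩
      rw [conj_pow, hk]; simp
  refine ⟨b, hb, ?_, a, ha, ha', rfl⟩
  have := mul_mem hg (inv_mem ha')
  simpa using this

lemma nil_subgroupOf {A : Subgroup G} (hA : Group.IsNilpotent A) (H : Subgroup G) :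
    Group.IsNilpotent (A.subgroupOf H) := by
  have h1 : Group.IsNilpotent (A ⊓ H : Subgroup G) := nil_of_le hA inf_le_left
  rw [← inf_subgroupOf_right]
  exact Group.nilpotent_of_mulEquiv (Subgroup.subgroupOfEquivOfLe inf_le_right).symm

lemma card_subgroupOf (A H : Subgroup G) :
    Nat.card (A.subgroupOf H) = Nat.card (A ⊓ H : Subgroup G) := by
  rw [← inf_subgroupOf_right]
  exact Nat.card_congr (Subgroup.subgroupOfEquivOfLe inf_le_right).toEquiv

lemma Fz.sub {A B H : Subgroup G} (h : Fz A B H) :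
    ∀ g : H, ∃ t ∈ A.subgroupOf H, ∃ s ∈ B.subgroupOf H, g = t * s := by
  rintro ⟨g, hg⟩
  obtain ⟨a, ha, haH, b, hb, hbH, e⟩ := h g hg
  exact ⟨⟨a, haH⟩, ha, ⟨b, hbH⟩, hb, Subtype.ext e⟩

lemma Hyp.cop_sub (h : Hyp A B) (H : Subgroup G) :
    Nat.Coprime (Nat.card (A.subgroupOf H)) (Nat.card (B.subgroupOf H)) := by
  rw [card_subgroupOf, card_subgroupOf]
  exact Nat.Coprime.coprime_dvd_left (card_dvd_of_le inf_le_left)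
    (Nat.Coprime.coprime_dvd_right (card_dvd_of_le inf_le_left) h.cop)

lemma map_le_of {H : Subgroup G} {W : Subgroup H} {B : Subgroup G} (h : W ≤ B.subgroupOf H) :
    W.map H.subtype ≤ B := by
  rintro _ ⟨x, hx, rfl⟩
  exact h hx

lemma nz_map {H : Subgroup G} {W : Subgroup H} (hW : W.Normal) :
    H ≤ normalizer ((W.map H.subtype : Subgroup G) : Set G) := by
  intro g hg
  apply mem_nz
  rintro _ ⟨x, hx, rfl⟩
  exact ⟨_, hW.conj_mem x hx ⟨g, hg⟩, rfl⟩

lemma map_ne {H : Subgroup G} {W : Subgroup H} (hW : W.map H.subtype = ⊥) : W = ⊥ :=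
  (map_eq_bot_iff_of_injective W H.subtype_injective).1 hW

lemma zp_nz {A : Subgroup G} {z : G} (hzc : ∀ a ∈ A, a * z = z * a) :
    A ≤ normalizer (zpowers z : Set G) := by
  intro a ha
  apply mem_nz
  rintro _ ⟨n, rfl⟩
  have h1 : a * z * a⁻¹ = z := by rw [hzc a ha]; simp
  have : a * z ^ n * a⁻¹ = (a * z * a⁻¹) ^ n := by rw [conj_zpow]
  simp only
  rw [this, h1]
  exact ⟨n, rfl⟩

/-- Lemma L -/
lemma Hyp.lemL (h : Hyp A B) {H : Subgroup G} (hH : H ≠ ⊤) (hf : Fz A B H) {q : ℕ} (hq : q.Prime)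
    (hqB : q ∣ Nat.card B) (hB : ∀ l, l.Prime → l ≠ q → pp B l ≤ H) {p : ℕ} (hp : p.Prime)
    (hpA : p ∣ Nat.card A) {z : G} (hz : z ∈ pp A p) (hz1 : z ≠ 1) (hzc : ∀ a ∈ A, a * z = z * a)
    (hzH : z ∈ H) : ∃ U : Subgroup G, U ≤ pp A p ∧ z ∈ U ∧ A ⊓ H ≤ normalizer (U : Set G) ∧
      ∀ l, l.Prime → l ≠ q → l ∣ Nat.card B → pp B l ≤ normalizer (U : Set G) := by
  have hzA := pp_le A p hz
  have hs : Group.IsSolvable H := h.sub H hH hf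
  obtain ⟨M, L, hM, hL, hML, hMq, hzL, hLM⟩ := L0 hs (nil_subgroupOf h.nA H) (nil_subgroupOf h.nB H)
    hf.sub (h.cop_sub H) hp hq (by
      rw [card_subgroupOf]
      exact fun hd => not_dvd_both h.symm hq hqB (hd.trans (card_dvd_of_le inf_le_left)))
    (z := ⟨z, hzH⟩) hzA (by
      rintro ⟨t, htH⟩ ht
      exact Subtype.ext (hzc t ht)) (by
      obtain ⟨k, hk⟩ := pg_mem (pp_pg h.nA hp) hz
      exact ⟨k, Subtype.ext hk⟩) (by
      intro l hl hlq W hW hWl hWS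
      apply map_ne
      by_contra hne
      have h1 := map_le_of hWS
      have h2 := nz_map hW
      have h3 : IsPGroup l (W.map H.subtype) := hWl.map _
      set W' := W.map H.subtype
      have h4 : W' ≤ pp B l := fun x hx => mem_pp' (h1 hx) (pg_mem h3 hx)
      have h5 : B ≤ normalizer (W' : Set G) := by
        apply le_of_pp h.nB
        intro s hs hsB
        by_cases hsl : s = l
        · subst hsl; exact (hB s hs hlq).trans h2
        · exact (pp_le_cent h.nB hl hs hsl h4).trans (cent_le_nz W')
      have h6 := h.symm.F2 h5 (h.nz_ne_top hne (h.symm.ne_top h1)) (Z := zpowers z)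
        (by simpa using hzA) (zp_nz hzc) (by simpa using h2 hzH)
      exact hz1 (by simpa using h6))
  -- push to `G`
  have hM' : IsPGroup q (M.map H.subtype) := hMq.map _
  have hnM := nz_map hM
  have hnL := nz_map hL
  have hML' : M.map H.subtype ≤ L.map H.subtype := map_mono hML
  have hLH : L.map H.subtype ≤ H := map_subtype_le L
  have hzL' : z ∈ L.map H.subtype := ⟨_, hzL, rfl⟩
  have hLM' : ∀ x ∈ L.map H.subtype, ∃ k, x ^ p ^ k ∈ M.map H.subtype := by
    rintro _ ⟨x, hx, rfl⟩
    obtain ⟨k, hk⟩ := hLM x hx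
    exact ⟨k, _, hk, by simp⟩
  generalize M.map H.subtype = M' at *
  generalize L.map H.subtype = L' at *
  have hS := h.sylH hp hpA hf
  have hU := hS.inf_normal hp hLH hnL
  set U := pp (A ⊓ H) p ⊓ L' with hUdef
  have hUA : A ⊓ H ≤ normalizer (U : Set G) := by
    intro g hg
    apply mem_nz
    intro x hx
    exact ⟨nz_conj (pp_nz' (A ⊓ H) p hg) hx.1, nz_conj (hnL hg.2) hx.2⟩
  refine ⟨U, inf_le_left.trans (pp_mono inf_le_left p), ⟨mem_pp' ⟨hzA, hzH⟩ (pg_mem (pp_pg h.nA hp) hz),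
    hzL'⟩, hUA, ?_⟩
  -- L' = U ⊔ M'
  have hUM : U ≤ normalizer (M' : Set G) := fun x hx => hnM (hLH hx.2)
  have hLe : L' ≤ U ⊔ M' := by
    have h1 : Nat.card L' ∣ Nat.card (U ⊔ M' : Subgroup G) := by
      apply card_dvd_of_syl Nat.card_pos.ne'
      intro s hs hd
      by_cases hsp : s = p
      · subst hsp
        exact ⟨U, hU, card_dvd_of_le le_sup_left⟩
      · obtain ⟨Q, hQ, -⟩ := exists_syl hs (X := L') (Q := ⊥) IsPGroup.of_bot bot_le
        refine ⟨Q, hQ, card_dvd_of_le (le_trans ?_ le_sup_right)⟩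
        intro x hx
        obtain ⟨k, hk⟩ := hLM' x (hQ.le hx)
        obtain ⟨j, hj⟩ := pg_mem hQ.pg hx
        have hc : Nat.Coprime (orderOf x) (p ^ k) := Nat.Coprime.coprime_dvd_left
          (orderOf_dvd_of_pow_eq_one hj) (Nat.Coprime.pow _ _ ((Nat.coprime_primes hs hp).2 hsp))
        obtain ⟨m, hm⟩ := exists_pow_eq_self_of_coprime hc.symm
        rw [← hm]
        exact M'.pow_mem hk m
    have h2 : U ⊔ M' = L' := by
      refine Subgroup.eq_of_le_of_card_ge (sup_le inf_le_right hML') (Nat.le_of_dvd Nat.card_pos h1)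
    exact h2.ge
  let Y := normalizer (U : Set G) ⊓ H
  have hYf : Fz A B Y := by
    intro y hy
    obtain ⟨a, ha, haH, b, hb, hbH, e⟩ := hf y hy.2
    have haY : a ∈ Y := ⟨hUA ⟨ha, haH⟩, haH⟩
    refine ⟨a, ha, haY, b, hb, ?_, e⟩
    have : b = a⁻¹ * y := by rw [e]; group
    rw [this]
    exact Y.mul_mem (Y.inv_mem haY) hy
  have hMH : M' ≤ H := hML'.trans hLH
  have hYM : Y ⊔ M' = H := by
    apply le_antisymm (sup_le inf_le_right hMH)
    intro x hx
    obtain ⟨n, hn, hnx⟩ := hU.frattini hp (hnL hx)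
    have hUY : U ≤ Y := le_inf le_normalizer (inf_le_right.trans hLH)
    have h1 : n ∈ Y ⊔ M' := (sup_le_sup_right hUY M') (hLe hn)
    have h2 : n * x ∈ Y := ⟨hnx, H.mul_mem (hLH hn) hx⟩
    have h3 := (Y ⊔ M').mul_mem ((Y ⊔ M').inv_mem h1) ((le_sup_left : Y ≤ Y ⊔ M') h2)
    simpa using h3
  have hdv : Y.relIndex H ∣ Nat.card M' := by
    have h1 := card_sup_dvd (A := Y) (N := M') (fun y hy => hnM hy.2)
    rw [hYM, ← card_relIndex (inf_le_right : Y ≤ H)] at h1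
    exact Nat.dvd_of_mul_dvd_mul_left Nat.card_pos h1
  intro l hl hlq hlB
  have h1 : Syl l (pp (B ⊓ Y) l) H := by
    refine (h.symm.sylH hl hlB hYf.symm).up hl (m := Y.relIndex H) inf_le_right
      (card_relIndex inf_le_right).symm ?_
    intro hd
    obtain ⟨n, hn⟩ := card_pow hq hM'
    have := hd.trans hdv
    rw [hn] at this
    exact hlq ((Nat.prime_dvd_prime_iff_eq hl hq).1 (hl.dvd_of_dvd_pow this))
  obtain ⟨x, hx, hxc⟩ := h1.conj hl (pp_pg h.nB hl) (hB l hl hlq)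
  have h2 : pp (B ⊓ Y) l = pp B l := by
    apply Subgroup.eq_of_le_of_card_ge (pp_mono inf_le_left l)
    rw [← card_cj x (pp B l)]
    exact Nat.le_of_dvd Nat.card_pos (card_dvd_of_le hxc)
  rw [← h2]
  exact (pp_le _ _).trans (inf_le_right.trans inf_le_left)

end main
end KW

set_option linter.all false
namespace KW
open Subgroup
open scoped commutatorElement

section main5
variable {G : Type*} [Group G] [Finite G]
variable {A B : Subgroup G}

lemma exists_prime_dvd {D : Subgroup G} (h : D ≠ ⊥) : ∃ q, q.Prime ∧ q ∣ Nat.card D :=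
  Nat.exists_prime_and_dvd fun e => h (card_eq_one.1 e)

lemma ne_bot_of_mem {U : Subgroup G} {z : G} (hz : z ∈ U) (h1 : z ≠ 1) : U ≠ ⊥ := by
  rintro rfl; exact h1 (mem_bot.1 hz)

lemma Hyp.lemU (h : Hyp A B) {U : Subgroup G} (hU : U ≤ A) (hb : U ≠ ⊥)
    (hA : A ≤ normalizer (U : Set G)) {s : ℕ} (hs : s.Prime) (hsB : s ∣ Nat.card B)
    (hB : pp B s ≤ normalizer (U : Set G)) : False :=
  pp_ne_bot h.nB hs hsB (h.F2 hA (h.nz_ne_top hb (h.ne_top hU)) (pp_le B s) (pp_nz' B s) hB)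

lemma Hyp.lemD (h : Hyp A B) {E : Subgroup G} (hE : A ≤ normalizer (E : Set G))
    (hne : B ⊓ E ≠ ⊥) {r : ℕ} (hr : r.Prime) (hrA : r ∣ Nat.card A)
    {z : G} (hz : z ∈ pp A r) (hz1 : z ≠ 1) (hzc : ∀ a ∈ A, a * z = z * a)
    (hzE : z ∈ centralizer (E : Set G)) :
    ∃ U : Subgroup G, U ≤ pp A r ∧ z ∈ U ∧ A ⊓ centralizer (E : Set G) ≤ normalizer (U : Set G) ∧
      ∃ s, s.Prime ∧ s ∣ Nat.card B ∧ pp B s ≤ normalizer (U : Set G) := by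
  obtain ⟨q, hq, hqD⟩ := exists_prime_dvd hne
  have nD : Group.IsNilpotent (B ⊓ E : Subgroup G) := nil_of_le h.nB inf_le_left
  have hqB : q ∣ Nat.card B := hqD.trans (card_dvd_of_le inf_le_left)
  set Dq := pp (B ⊓ E) q with hDq
  have hDqB : Dq ≤ pp B q := pp_mono inf_le_left q
  have hDE : Dq ≤ E := (pp_le _ _).trans inf_le_right
  have hDb : Dq ≠ ⊥ := pp_ne_bot nD hq hqD
  have hcE : centralizer (E : Set G) ≤ normalizer (Dq : Set G) :=
    (centralizer_le hDE).trans (cent_le_nz _)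
  obtain ⟨U, hU1, hU2, hU3, hU4⟩ := h.lemL (H := normalizer (Dq : Set G))
    (h.nz_ne_top hDb (h.symm.ne_top (hDqB.trans (pp_le _ _))))
    (h.nz_fz (hDqB.trans (pp_le _ _)) hDE (pp_pg nD hq) hE
      (fun x hx hxE hk => mem_pp' ⟨hx, hxE⟩ hk)) hq hqB
    (fun l hl hlq => (pp_le_cent h.nB hq hl hlq hDqB).trans (cent_le_nz _)) hr hrA hz hz1 hzc
    (hcE hzE)
  obtain ⟨s, hs, hsq, hsB⟩ := h.mB q
  exact ⟨U, hU1, hU2, (inf_le_inf le_rfl hcE).trans hU3, s, hs, hsB, hU4 s hs hsq hsB⟩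

lemma Hyp.cB (h : Hyp A B) {r : ℕ} (hr : r.Prime) (hrA : r ∣ Nat.card A) :
    B ⊓ centralizer (pp A r : Set G) = ⊥ := by
  by_contra hD
  obtain ⟨z, hz, hz1, hzc⟩ := exists_central_pp h.nA hr hrA
  have hle : pp A r ≤ centralizer ((centralizer (pp A r : Set G) : Subgroup G) : Set G) := by
    intro x hx
    rw [mem_centralizer_iff]
    intro y hy
    exact (mem_centralizer_iff.1 hy x hx).symm
  obtain ⟨U, hU1, hU2, hU3, s, hs, hsB, hU4⟩ := h.lemD ((pp_nz' A r).trans (nz_le_cent_nz _)) hD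
    hr hrA hz hz1 hzc (hle hz)
  refine h.lemU (hU1.trans (pp_le _ _)) (ne_bot_of_mem hU2 hz1) (le_of_pp h.nA ?_) hs hsB hU4
  intro t ht htA
  by_cases htr : t = r
  · subst htr; exact (le_inf (pp_le _ _) hle).trans hU3
  · exact (pp_le_cent h.nA hr ht htr hU1).trans (cent_le_nz _)

lemma Hyp.cent_le (h : Hyp A B) {r : ℕ} (hr : r.Prime) (hrA : r ∣ Nat.card A) :
    centralizer (pp A r : Set G) ≤ A := by
  have hn := (pp_nz' A r).trans (nz_le_cent_nz (pp A r))
  refine le_of_coprime_nz le_top le_top h.cardG h.cop ?_ hn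
  rw [Nat.coprime_iff_gcd_eq_one]
  by_contra hne
  obtain ⟨q, hq, hqd⟩ := Nat.exists_prime_and_dvd hne
  have hqC := hqd.trans (Nat.gcd_dvd_left _ _)
  have hqB := hqd.trans (Nat.gcd_dvd_right _ _)
  obtain ⟨c, hc, hco⟩ := exists_prime_order hq hqC
  have hc1 : c ^ q ^ 1 = 1 := by rw [pow_one, ← hco, pow_orderOf_eq_one]
  obtain ⟨a, ha, hle⟩ := h.symm.conjA hq hqB (pg_zpowers ⟨1, hc1⟩)
  have h1 : a * c * a⁻¹ ∈ B ⊓ centralizer (pp A r : Set G) :=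
    ⟨pp_le _ _ (hle (conj_mem_cj (mem_zpowers c))), nz_conj (hn ha) hc⟩
  rw [h.cB hr hrA, mem_bot, conj_eq_one_iff] at h1
  rw [h1, orderOf_one] at hco
  exact hq.one_lt.ne hco

lemma Hyp.nz_pp_le (h : Hyp A B) {r : ℕ} (hr : r.Prime) (hrA : r ∣ Nat.card A) :
    normalizer (pp A r : Set G) ≤ normalizer (A : Set G) := by
  intro g hg
  apply mem_nz
  suffices A ≤ cj g⁻¹ A by
    intro x hx
    simpa [mem_cj] using this hx
  apply le_of_pp h.nA
  intro t ht htA x hx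
  rw [mem_cj, inv_inv]
  by_cases htr : t = r
  · subst htr; exact pp_le _ _ (nz_conj hg hx)
  · exact h.cent_le hr hrA (nz_conj (nz_le_cent_nz _ hg) (pp_le_cent h.nA hr ht htr le_rfl hx))

lemma pow_conj_eq {g x : G} {n : ℕ} (h : x ^ n = 1) : (g * x * g⁻¹) ^ n = 1 := by
  rw [conj_pow, h]; simp

lemma Hyp.fusion (h : Hyp A B) {p : ℕ} (hp : p.Prime) {x g : G} (hx : x ∈ pp A p)
    (hxc : ∀ a ∈ A, a * x = x * a) (hg : g * x * g⁻¹ ∈ A) :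
    ∀ a ∈ A, a * (g * x * g⁻¹) = (g * x * g⁻¹) * a := by
  obtain ⟨r, hr, hrp, hrA⟩ := h.mA p
  obtain ⟨k, hk⟩ := pg_mem (pp_pg h.nA hp) hx
  have hy : g * x * g⁻¹ ∈ pp A p := mem_pp' hg ⟨k, pow_conj_eq hk⟩
  obtain ⟨c, hc, hn⟩ := (h.syl hr hrA).conjSyl hr (C := centralizer {g * x * g⁻¹}) (g := g) (by
      intro u hu
      rw [mem_centralizer_singleton_iff]
      exact pp_comm h.nA hr hp hrp hu hy) le_top (by
      intro u hu
      rw [mem_cj] at hu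
      rw [mem_centralizer_singleton_iff]
      have := hxc _ (pp_le _ _ hu)
      have h2 := congrArg (fun x => g * x * g⁻¹) this
      simpa [mul_assoc] using h2)
  have hn := h.nz_pp_le hr hrA hn
  have e : (c * g) * x * (c * g)⁻¹ = g * x * g⁻¹ := by
    have := mem_cent_conj.1 hc
    rw [← this]; group
  intro a ha
  rw [← e]
  have := hxc _ (nz_conj' hn ha)
  have h2 := congrArg (fun y => (c * g) * y * (c * g)⁻¹) this
  simpa [mul_assoc] using h2

lemma Hyp.cx (h : Hyp A B) {p : ℕ} (hp : p.Prime) {x : G} (hx : x ∈ pp A p) (hx1 : x ≠ 1)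
    (hxc : ∀ a ∈ A, a * x = x * a) : B ⊓ centralizer ({x} : Set G) = ⊥ := by
  by_contra hD
  have hpA : p ∣ Nat.card A := dvd_of_pp_ne h.nA hp (ne_bot_of_mem hx hx1)
  have hAE : A ≤ centralizer ({x} : Set G) := fun a ha => mem_centralizer_singleton_iff.2 (hxc a ha)
  obtain ⟨U, hU1, hU2, -, s, hs, hsB, hU4⟩ := h.lemD (hAE.trans le_normalizer) hD
    hp hpA hx hx1 hxc (mem_centralizer_iff.2 fun y hy => mem_centralizer_singleton_iff.1 hy)
  set X1 := closure {y | ∃ b ∈ pp B s, y = b * x * b⁻¹} with hX1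
  have hle : X1 ≤ A := by
    rw [hX1, closure_le]
    rintro _ ⟨b, hb, rfl⟩
    exact pp_le _ _ (hU1 (nz_conj (hU4 hb) hU2))
  have hc : X1 ≤ centralizer (A : Set G) := by
    rw [hX1, closure_le]
    rintro _ ⟨b, hb, rfl⟩
    rw [SetLike.mem_coe, mem_centralizer_iff]
    exact h.fusion hp hx hxc (pp_le _ _ (hU1 (nz_conj (hU4 hb) hU2)))
  refine h.lemU hle (ne_bot_of_mem (z := x) (Subgroup.subset_closure ⟨1, one_mem _, by simp⟩) hx1) ?_
    hs hsB ?_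
  · intro a ha
    apply mem_nz
    intro y hy
    rw [mem_centralizer_iff.1 (hc hy) a ha]; simpa using hy
  · intro b hb
    apply nz_of_cj_le
    rw [cj, map_le_iff_le_comap, hX1, closure_le]
    rintro _ ⟨b', hb', rfl⟩
    refine Subgroup.subset_closure ⟨b * b', mul_mem hb hb', ?_⟩
    simp [mul_assoc]

lemma Hyp.centx (h : Hyp A B) {p : ℕ} (hp : p.Prime) {x : G} (hx : x ∈ pp A p) (hx1 : x ≠ 1)
    (hxc : ∀ a ∈ A, a * x = x * a) : centralizer ({x} : Set G) = A := by
  have hAE : A ≤ centralizer ({x} : Set G) := fun a ha => mem_centralizer_singleton_iff.2 (hxc a ha)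
  apply le_antisymm _ hAE
  intro g hg
  obtain ⟨a, ha, -, b, hb, hbE, rfl⟩ := h.fz_of_le hAE g hg
  have : b ∈ B ⊓ centralizer ({x} : Set G) := ⟨hb, hbE⟩
  rw [h.cx hp hx hx1 hxc, mem_bot] at this
  rw [this]; simpa using ha

end main5
end KW

set_option linter.all false
namespace KW
open Subgroup
open scoped commutatorElement

section main6
variable {G : Type*} [Group G] [Finite G]
variable {A B : Subgroup G}

lemma mem_sup_nz {A N : Subgroup G} (hn : A ≤ normalizer (N : Set G)) {x : G} (hx : x ∈ A ⊔ N) :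
    ∃ a ∈ A, ∃ n ∈ N, x = a * n := by
  let K : Subgroup G :=
    { carrier := {x | ∃ a ∈ A, ∃ n ∈ N, x = a * n}
      one_mem' := ⟨1, one_mem _, 1, one_mem _, by simp⟩
      mul_mem' := by
        rintro _ _ ⟨a, ha, n, hn', rfl⟩ ⟨a', ha', n', hn'', rfl⟩
        exact ⟨a * a', mul_mem ha ha', (a'⁻¹ * n * a') * n', mul_mem (nz_conj' (hn ha') hn') hn'',
          by group⟩
      inv_mem' := by
        rintro _ ⟨a, ha, n, hn', rfl⟩
        exact ⟨a⁻¹, inv_mem ha, a * n⁻¹ * a⁻¹, nz_conj (hn ha) (inv_mem hn'), by group⟩ }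
  have : A ⊔ N ≤ K := sup_le (fun a ha => ⟨a, ha, 1, one_mem _, by simp⟩)
    (fun n hn => ⟨1, one_mem _, n, hn, by simp⟩)
  exact this hx

lemma Hyp.A_bot (h : Hyp A B) : A ≠ ⊥ := by
  rintro rfl
  obtain ⟨r, hr, -, hd⟩ := h.mA 0
  rw [card_bot] at hd
  exact hr.one_lt.ne' (Nat.dvd_one.1 hd)

lemma Hyp.NA_ne (h : Hyp A B) : normalizer (A : Set G) ≠ ⊤ := h.nz_ne_top h.A_bot h.A_ne

lemma Hyp.conj_card (h : Hyp A B) {r : ℕ} (hr : r.Prime) (hrA : r ∣ Nat.card A) {X : Subgroup G}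
    (hX : Nat.card (pp A r) ∣ Nat.card X) : ∃ b ∈ B, pp A r ≤ cj b X := by
  obtain ⟨R, hR, -⟩ := exists_syl hr (X := X) (Q := ⊥) (IsPGroup.of_bot) bot_le
  obtain ⟨b, hb, hle⟩ := h.conjA hr hrA hR.pg
  obtain ⟨n, hn⟩ := card_pow hr (pp_pg h.nA hr)
  have hd : Nat.card (pp A r) ∣ Nat.card R := by
    have h1 := card_relIndex hR.le
    rw [hn] at hX ⊢
    rw [← h1] at hX
    exact (Nat.Coprime.pow_left n ((Nat.Prime.coprime_iff_not_dvd hr).2 hR.nd)).dvd_of_dvd_mul_right hX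
  have e : cj b R = pp A r := by
    apply eq_of_le_of_card_ge hle
    rw [card_cj]
    exact Nat.le_of_dvd Nat.card_pos hd
  exact ⟨b, hb, e ▸ cj_mono b hR.le⟩

lemma Hyp.not_NB (h : Hyp A B) {r : ℕ} (hr : r.Prime) (hrA : r ∣ Nat.card A)
    (hX : Nat.card (pp A r) ∣ Nat.card (normalizer (B : Set G))) : False := by
  obtain ⟨b, hb, hle⟩ := h.conj_card hr hrA hX
  rw [mem_nz_cj.1 (le_normalizer (le_normalizer hb))] at hle
  exact pp_ne_bot h.nA hr hrA (h.symm.F2 le_normalizer h.symm.NA_ne (pp_le _ _) (pp_nz' _ _) hle)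

lemma Hyp.nb0 (h : Hyp A B) {r s : ℕ} (hr : r.Prime) (hrA : r ∣ Nat.card A) (hs : s.Prime)
    {V : Subgroup G} (hV : V ≤ pp B s) (hn : pp A r ≤ normalizer (V : Set G)) : V = ⊥ := by
  obtain ⟨t, ht, hts, htB⟩ := h.mB s
  set C := centralizer (V : Set G) with hC
  have htC : pp B t ≤ C := pp_le_cent h.nB hs ht hts hV
  have hJC : normalizer (V : Set G) ≤ normalizer (C : Set G) := nz_le_cent_nz V
  have hCJ : C ≤ normalizer (V : Set G) := cent_le_nz V
  by_cases hb : C ⊓ pp A r = ⊥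
  · exfalso
    have hle : normalizer (V : Set G) ≤ (normalizer (V : Set G) ⊓ normalizer (B : Set G)) ⊔ C := by
      intro g hg
      obtain ⟨c, hc, hcg⟩ := ((h.symm.syl ht htB).of_le htC le_top).frattini ht (hJC hg)
      have h1 : c * g ∈ normalizer (V : Set G) ⊓ normalizer (B : Set G) :=
        ⟨mul_mem (hCJ hc) hg, h.symm.nz_pp_le ht htB hcg⟩
      have : g = c⁻¹ * (c * g) := by group
      rw [this]
      exact mul_mem (le_sup_right (a := normalizer (V : Set G) ⊓ normalizer (B : Set G)) (C.inv_mem hc)) (le_sup_left (b := C) h1)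
    have h1 := card_sup_dvd (A := normalizer (V : Set G) ⊓ normalizer (B : Set G)) (N := C)
      (inf_le_left.trans hJC)
    have h2 : Nat.card (pp A r ⊔ C : Subgroup G) = Nat.card (pp A r) * Nat.card C := by
      apply card_inj _ le_sup_left le_sup_right
      · intro x hx
        exact mem_sup_nz (hn.trans hJC) hx
      · rw [inf_comm, hb]
    have h3 := (card_dvd_of_le ((sup_le hn hCJ).trans hle)).trans h1
    rw [h2] at h3
    exact h.not_NB hr hrA ((Nat.dvd_of_mul_dvd_mul_right Nat.card_pos h3).trans
      (card_dvd_of_le inf_le_right))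
  · obtain ⟨x, hx, hx1, hxc⟩ := exists_central h.nA (N := C ⊓ pp A r) (inf_le_right.trans (pp_le _ _))
      (by
        apply le_of_pp h.nA
        intro t ht htA
        by_cases htr : t = r
        · subst htr
          intro g hg
          apply mem_nz
          intro y hy
          exact ⟨nz_conj (hJC (hn hg)) hy.1, nz_conj (le_normalizer hg) hy.2⟩
        · exact (pp_le_cent h.nA hr ht htr inf_le_right).trans (cent_le_nz _)) hb
    rw [eq_bot_iff, ← h.cx hr hx.2 hx1 hxc]
    refine le_inf (hV.trans (pp_le _ _)) fun v hv => ?_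
    rw [mem_centralizer_singleton_iff]
    exact mem_centralizer_iff.1 hx.1 v hv

lemma nz_cj {P : Subgroup G} {g a : G} (hg : g ∈ normalizer (P : Set G)) :
    a * g * a⁻¹ ∈ normalizer (cj a P : Set G) := by
  rw [mem_nz_cj] at hg ⊢
  rw [← cj_mul, inv_mul_cancel_right, cj_mul, hg]

lemma cj_bot {P : Subgroup G} {a : G} (h : cj a P = ⊥) : P = ⊥ := by
  rw [← card_eq_one, ← card_cj a, h, card_bot]

lemma Hyp.nb (h : Hyp A B) {r s : ℕ} (hr : r.Prime) (hrA : r ∣ Nat.card A) (hs : s.Prime)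
    (hsB : s ∣ Nat.card B) {V : Subgroup G} (hV : IsPGroup s V)
    (hn : pp A r ≤ normalizer (V : Set G)) : V = ⊥ := by
  obtain ⟨a, ha, hle⟩ := h.symm.conjA hs hsB hV
  apply cj_bot (a := a)
  apply h.nb0 hr hrA hs hle
  intro x hx
  have := nz_cj (a := a) (hn (nz_conj' (pp_nz' A r ha) hx))
  simpa [mul_assoc] using this

lemma Hyp.M (h : Hyp A B) {H : Subgroup G} (hH : H ≠ ⊤) (hf : Fz A B H) {r : ℕ} (hr : r.Prime)
    (hrA : r ∣ Nat.card A) (hle : pp A r ≤ H) : H ≤ normalizer (A : Set G) := by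
  obtain ⟨z, hz, hz1, hzc⟩ := exists_central_pp h.nA hr hrA
  obtain ⟨k, hk⟩ := pg_mem (pp_pg h.nA hr) hz
  obtain ⟨L, hL, hLp, hzL⟩ := L00 (G := H) (T := A.subgroupOf H) (S := B.subgroupOf H)
    (h.sub H hH hf) (nil_subgroupOf h.nA H) hf.sub (h.cop_sub H) hr (z := ⟨z, hle hz⟩)
    (mem_subgroupOf.2 (pp_le _ _ hz)) (fun t ht => Subtype.ext (hzc _ (mem_subgroupOf.1 ht)))
    ⟨k, Subtype.ext (by simpa using hk)⟩ (by
      intro l hl W hW hWl hWB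
      by_contra hne
      have h1 : IsPGroup l (W.map H.subtype) := hWl.map _
      have h2 := map_le_of hWB
      have h3 : W.map H.subtype ≠ ⊥ := fun e => hne (map_ne e)
      have h4 : l ∣ Nat.card B := (pg_dvd hl h1 h3).trans (card_dvd_of_le h2)
      exact h3 (h.nb hr hrA hl h4 h1 (hle.trans (nz_map hW))))
  have hLle : L.map H.subtype ≤ pp A r :=
    ((h.syl hr hrA).of_le hle le_top).le_of_normal hr (hLp.map _)
      (by rintro _ ⟨x, -, rfl⟩; exact x.2) (nz_map hL)
  have hzL' : z ∈ L.map H.subtype := ⟨_, hzL, rfl⟩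
  intro g hg
  have hy := hLle (nz_conj (nz_map hL hg) hzL')
  have hc := h.fusion hr hz hzc (pp_le _ _ hy)
  have e := h.centx hr hy (by simpa using hz1) hc
  apply mem_nz
  intro a ha
  rw [← e, mem_centralizer_singleton_iff]
  have h2 := congrArg (fun y => g * y * g⁻¹) (hzc a ha)
  simpa [mul_assoc] using h2

lemma Hyp.conjN (h : Hyp A B) {p : ℕ} (hp : p.Prime) {P0 : Subgroup G} {g : G}
    (h1 : P0 ≤ pp A p) (h2 : P0 ≤ cj g (pp A p)) :
    ∃ c ∈ centralizer (P0 : Set G), c * g ∈ normalizer (A : Set G) := by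
  obtain ⟨r, hr, hrp, hrA⟩ := h.mA p
  obtain ⟨c, hc, hn⟩ := (h.syl hr hrA).conjSyl hr (C := centralizer (P0 : Set G)) (g := g)
    (pp_le_cent h.nA hp hr hrp h1) le_top (by
      intro u hu
      rw [mem_cj] at hu
      rw [mem_centralizer_iff]
      intro v hv
      have h3 := h2 hv
      rw [mem_cj] at h3
      have := pp_comm h.nA hp hr hrp.symm h3 hu
      have h2 := congrArg (fun x => g * x * g⁻¹) this
      simpa [mul_assoc] using h2)
  exact ⟨c, hc, h.nz_pp_le hr hrA hn⟩

lemma Hyp.d1' (h : Hyp A B) {p q : ℕ} (hp : p.Prime) (hq : q.Prime) {P0 : Subgroup G}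
    (h1 : P0 ≤ pp A p) (h0 : P0 ≠ ⊥) {d : G} (hdB : d ∈ pp B q) (hd1 : d ≠ 1)
    (hdA : d ∈ normalizer (A : Set G)) (hdC : d ∈ centralizer (P0 : Set G)) :
    normalizer (P0 : Set G) ≤ normalizer (A : Set G) := by
  have hdB' := pp_le _ _ hdB
  have hF : Fz A B (centralizer ({d} : Set G)) := by
    intro x hx
    obtain ⟨a, ha, b, hb, rfl⟩ := h.fact x
    have hx' := mem_cent_conj.1 hx
    have e : a⁻¹ * d * a = b * d * b⁻¹ := by
      have : a⁻¹ * (a * b * d * (a * b)⁻¹) * a = a⁻¹ * d * a := by rw [hx']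
      rw [← this]; group
    have e1 : a⁻¹ * d * a * d⁻¹ = 1 := by
      apply h.one
      · have := A.mul_mem (A.inv_mem ha) (nz_conj hdA ha)
        simpa [mul_assoc] using this
      · rw [e]
        exact mul_mem (mul_mem (mul_mem hb hdB') (inv_mem hb)) (inv_mem hdB')
    have e2 : b ∈ centralizer ({d} : Set G) := by
      rw [mem_cent_conj, ← e]; exact mul_inv_eq_one.1 e1
    refine ⟨a, ha, ?_, b, hb, e2, rfl⟩
    have := mul_mem hx (inv_mem e2)
    simpa using this
  have hne : centralizer ({d} : Set G) ≠ ⊤ := by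
    intro e
    refine h.nz_ne_top (V := zpowers d) (by simpa using hd1)
      (h.symm.ne_top (by simpa using hdB')) (top_le_iff.1 ?_)
    rw [← e]
    apply zp_nz
    intro a ha
    exact mem_centralizer_singleton_iff.1 ha
  obtain ⟨s, hs, hsq, hsB⟩ := h.mB q
  have hle := h.symm.M hne hF.symm hs hsB (fun u hu => mem_centralizer_singleton_iff.2
    (pp_comm h.nB hs hq hsq hu hdB))
  have hPB : P0 ≤ normalizer (B : Set G) := by
    intro u hu
    apply hle
    rw [mem_centralizer_singleton_iff]
    exact mem_centralizer_iff.1 hdC u hu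
  have hF2 : Fz B A (normalizer (P0 : Set G)) := by
    intro x hx
    obtain ⟨b, hb, a, ha, rfl⟩ := h.symm.fact x
    have hbc : b ∈ centralizer (P0 : Set G) := by
      rw [mem_centralizer_iff]
      intro u hu
      have h2 : b⁻¹ * u * b ∈ A := by
        have := nz_conj' hx hu
        have := A.mul_mem (A.mul_mem ha (pp_le _ _ (h1 this))) (A.inv_mem ha)
        simpa [mul_assoc] using this
      have h3 : u⁻¹ * (b⁻¹ * u * b) = 1 := by
        apply h.one (A.mul_mem (A.inv_mem (pp_le _ _ (h1 hu))) h2)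
        have := B.mul_mem (nz_conj' (hPB hu) (B.inv_mem hb)) hb
        simpa [mul_assoc] using this
      have h4 := (inv_mul_eq_one.1 h3).symm
      have : b * (b⁻¹ * u * b) = b * u := by rw [h4]
      rw [← this]; group
    have hb2 := cent_le_nz _ hbc
    refine ⟨b, hb, hb2, a, ha, ?_, rfl⟩
    have := mul_mem (inv_mem hb2) hx
    simpa using this
  obtain ⟨r, hr, hrp, hrA⟩ := h.mA p
  exact h.M (h.nz_ne_top h0 (h.ne_top (h1.trans (pp_le _ _)))) hF2.symm hr hrA
    ((pp_le_cent h.nA hp hr hrp h1).trans (cent_le_nz _))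

lemma Hyp.d1 (h : Hyp A B) {p q : ℕ} (hp : p.Prime) (hq : q.Prime) {P0 : Subgroup G}
    (h1 : P0 ≤ pp A p) (h0 : P0 ≠ ⊥) {d : G} (hd : orderOf d = q) (hqB : q ∣ Nat.card B)
    (hdA : d ∈ normalizer (A : Set G)) (hdC : d ∈ centralizer (P0 : Set G)) :
    normalizer (P0 : Set G) ≤ normalizer (A : Set G) := by
  have hd1 : d ^ q ^ 1 = 1 := by rw [pow_one, ← hd, pow_orderOf_eq_one]
  have hdne : d ≠ 1 := by
    rintro rfl; rw [orderOf_one] at hd; exact hq.one_lt.ne hd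
  obtain ⟨a, ha, hle⟩ := h.symm.conjA hq hqB (pg_zpowers ⟨1, hd1⟩)
  have haN : a ∈ normalizer (A : Set G) := le_normalizer ha
  have key := h.d1' hp hq (P0 := cj a P0) (d := a * d * a⁻¹)
    (by have := cj_mono a h1
        rwa [mem_nz_cj.1 (pp_nz' A p ha)] at this)
    (fun e => h0 (cj_bot e)) (hle (conj_mem_cj (mem_zpowers d))) (by simpa using hdne)
    (mul_mem (mul_mem haN hdA) (inv_mem haN)) (by
      rw [mem_centralizer_iff]
      intro u hu
      rw [SetLike.mem_coe, mem_cj] at hu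
      have := mem_centralizer_iff.1 hdC _ hu
      have h2 := congrArg (fun x => a * x * a⁻¹) this
      simpa [mul_assoc] using h2)
  intro g hg
  have := mul_mem (mul_mem (inv_mem haN) (key (nz_cj (a := a) hg))) haN
  simpa [mul_assoc] using this

end main6
end KW

set_option linter.all false
namespace KW
open Subgroup
open scoped commutatorElement

section main7
variable {G : Type*} [Group G] [Finite G]
variable {A B : Subgroup G}

lemma Hyp.le_A_of_nz (h : Hyp A B) {Y : Subgroup G} (hY : Y ≤ normalizer (A : Set G))
    (hc : Nat.Coprime (Nat.card Y) (Nat.card B)) : Y ≤ A := by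
  have h1 := card_sup_dvd hY
  have h2 : Nat.card (Y ⊔ A : Subgroup G) ∣ Nat.card A * Nat.card B := by
    rw [← h.cardG]; exact card_dvd_of_le le_top
  have h3 := Nat.Coprime.dvd_of_dvd_mul_right
    (Nat.Coprime.coprime_dvd_left h1 (Nat.Coprime.mul_left hc h.cop)) h2
  have h4 : A = Y ⊔ A := eq_of_le_of_card_ge le_sup_right (Nat.le_of_dvd Nat.card_pos h3)
  rw [h4]; exact le_sup_left

lemma Syl.mem_of_nz {p : ℕ} (hp : p.Prime) {P : Subgroup G} (hP : Syl p P ⊤) {y : G}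
    (hy : y ∈ normalizer (P : Set G)) (hk : ∃ k, y ^ p ^ k = 1) : y ∈ P := by
  obtain ⟨x, hx, hle⟩ := (hP.of_le le_normalizer le_top).conj hp (pg_zpowers hk)
    (by simpa using hy)
  have := nz_conj' hx (hle (conj_mem_cj (mem_zpowers y)))
  simpa [mul_assoc] using this

lemma mul_pow_mem {C : Subgroup G} {u c : G} (hu : u ∈ normalizer (C : Set G)) (hc : c ∈ C) (n : ℕ) :
    (u ^ n)⁻¹ * (u * c) ^ n ∈ C := by
  induction n with
  | zero => simp
  | succ n ih =>
    have : (u ^ (n + 1))⁻¹ * (u * c) ^ (n + 1) = (u⁻¹ * ((u ^ n)⁻¹ * (u * c) ^ n) * u) * c := by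
      rw [pow_succ, pow_succ]; group
    rw [this]
    exact mul_mem (nz_conj' hu ih) hc

lemma mem_of_pow_cop {C : Subgroup G} {x : G} {m n : ℕ} (h : Nat.Coprime m n) (h1 : x ^ m ∈ C)
    (h2 : x ^ n = 1) : x ∈ C := by
  have h3 : x ^ ((m : ℤ) * m.gcdA n + n * m.gcdB n) = x := by
    rw [← Nat.gcd_eq_gcd_ab, h]; simp
  rw [zpow_add, zpow_mul, zpow_mul, zpow_natCast, zpow_natCast, h2, one_zpow, mul_one] at h3
  rw [← h3]
  exact zpow_mem h1 _

lemma Hyp.d_step (h : Hyp A B) {p : ℕ} (hp : p.Prime) {P0 : Subgroup G} (h1 : P0 ≤ pp A p)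
    (h0 : P0 ≠ ⊥)
    (ih : ∀ P1, P1 ≤ pp A p → Nat.card P0 < Nat.card P1 → normalizer (P1 : Set G) ≤ normalizer (A : Set G)) :
    normalizer (P0 : Set G) ≤ normalizer (A : Set G) := by
  by_contra hbad
  have hpA : p ∣ Nat.card A := (pg_dvd hp ((pp_pg h.nA hp).to_le h1) h0).trans
    (card_dvd_of_le (h1.trans (pp_le _ _)))
  have hlt : P0 < pp A p := by
    refine lt_of_le_of_ne h1 ?_
    rintro rfl
    exact hbad (h.nz_pp_le hp hpA)
  obtain ⟨x, hxP, hx0, hxn⟩ := nz_grow hp (pp_pg h.nA hp) hlt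
  set J := normalizer (P0 : Set G) with hJ
  set P1 := pp A p ⊓ J with hP1
  have hP01 : P0 < P1 := by
    refine lt_of_le_of_ne (le_inf h1 le_normalizer) fun e => hx0 ?_
    rw [e]; exact ⟨hxP, hxn⟩
  have hP1A : P1 ≤ pp A p := inf_le_left
  have hN1 := ih P1 inf_le_left (card_lt hP01)
  have hP1p : IsPGroup p P1 := (pp_pg h.nA hp).to_le hP1A
  have hSyl : Syl p P1 J := by
    obtain ⟨S, hS, hPS⟩ := exists_syl hp hP1p (inf_le_right : P1 ≤ J)
    rcases hPS.eq_or_lt with e | hlt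
    · rw [e]; exact hS
    · exfalso
      obtain ⟨y, hyS, hy1, hyn⟩ := nz_grow hp hS.pg hlt
      exact hy1 ⟨(h.syl hp hpA).mem_of_nz hp (pp_nz _ _ (hN1 hyn)) (pg_mem hS.pg hyS), hS.le hyS⟩
  set C := centralizer (P0 : Set G) with hC
  have hJC : J ≤ normalizer (C : Set G) := nz_le_cent_nz P0
  have hCJ : C ≤ J := cent_le_nz P0
  set X := P1 ⊔ C with hX
  have hXJ : X ≤ J := sup_le inf_le_right hCJ
  have hCX : C ≤ X := le_sup_right
  have hP1X : P1 ≤ X := le_sup_left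
  have hSX : Syl p P1 X := hSyl.of_le hP1X hXJ
  have hYA : X ⊓ normalizer (A : Set G) ≤ A := by
    apply h.le_A_of_nz inf_le_right
    rw [Nat.coprime_iff_gcd_eq_one]
    by_contra hne
    obtain ⟨q, hq, hqd⟩ := Nat.exists_prime_and_dvd hne
    have hqY := hqd.trans (Nat.gcd_dvd_left _ _)
    have hqB := hqd.trans (Nat.gcd_dvd_right _ _)
    obtain ⟨d, hd, hdo⟩ := exists_prime_order hq hqY
    have hqp : p ≠ q := by
      rintro rfl; exact not_dvd_both h hp hpA hqB
    refine hbad (h.d1 hp hq h1 h0 hdo hqB hd.2 ?_)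
    obtain ⟨u, hu, c, hc, e⟩ := mem_sup_nz ((inf_le_right : P1 ≤ J).trans hJC) hd.1
    obtain ⟨k, hk⟩ := pg_mem hP1p hu
    have h3 := mul_pow_mem (hJC (inf_le_right (a := pp A p) hu)) hc (p ^ k)
    rw [hk, inv_one, one_mul, ← e] at h3
    exact mem_of_pow_cop (n := q) (Nat.Coprime.pow_left k ((Nat.coprime_primes hp hq).2 hqp)) h3
      (by rw [← hdo, pow_orderOf_eq_one])
  obtain ⟨r, hr, hrp, hrA⟩ := h.mA p
  have hQC : pp A r ≤ C := pp_le_cent h.nA hp hr hrp h1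
  have hQ := h.syl hr hrA
  have hK : ¬ r ∣ Nat.card (OO X r) := by
    apply transfer_lemma hr (hQ.of_le (hQC.trans hCX) le_top)
    intro w hw g hg hw'
    obtain ⟨c, hc, hn⟩ := hSX.conjSyl hp (C := centralizer {g * w * g⁻¹} ⊓ X) (g := g) (by
        refine le_inf ?_ hP1X
        intro u hu
        rw [mem_centralizer_singleton_iff]
        exact pp_comm h.nA hp hr hrp.symm (hP1A hu) hw') inf_le_right (by
        intro u hu
        rw [mem_cj] at hu
        refine mem_inf.2 ⟨?_, ?_⟩
        · rw [mem_centralizer_singleton_iff]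
          have := pp_comm h.nA hp hr hrp.symm (hP1A hu) hw
          have h2 := congrArg (fun x => g * x * g⁻¹) this
          simpa [mul_assoc] using h2
        · have := mul_mem (mul_mem hg (hP1X hu)) (inv_mem hg)
          simpa [mul_assoc] using this)
    have hnA : c * g ∈ A := hYA ⟨mul_mem hc.2 hg, hN1 hn⟩
    have e : (c * g) * w * (c * g)⁻¹ = g * w * g⁻¹ := by
      have := mem_cent_conj.1 hc.1
      rw [← this]; group
    obtain ⟨u, hu, v, hv, e2, hcomm, -⟩ := pp_decomp h.nA hr hnA
    refine ⟨u, hu, ?_⟩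
    rw [← e, e2]
    have : v * w * v⁻¹ = w := by rw [hcomm w hw]; simp
    calc u * v * w * (u * v)⁻¹ = u * (v * w * v⁻¹) * u⁻¹ := by group
      _ = _ := by rw [this]
  have hXB : ∀ s, s.Prime → s ∣ Nat.card B → ¬ s ∣ Nat.card X := by
    intro s hs hsB hsX
    have hsr : s ≠ r := by
      rintro rfl; exact not_dvd_both h hr hrA hsB
    obtain ⟨y, hy, hyo⟩ := exists_prime_order hs hsX
    have hyK : y ∈ OO X r := Subgroup.subset_closure
      ⟨hy, s, fun hd => hsr ((Nat.prime_dvd_prime_iff_eq hr hs).1 hd).symm, by rw [← hyo, pow_orderOf_eq_one]⟩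
    have hsK : s ∣ Nat.card (OO X r) := by
      rw [← hyo]
      have := orderOf_dvd_natCard (⟨y, hyK⟩ : OO X r)
      rwa [Subgroup.orderOf_mk] at this
    obtain ⟨S, hS, -⟩ := exists_syl hs (X := OO X r) (Q := ⊥) (IsPGroup.of_bot) bot_le
    have hSb := hS.dvd_card hs hsK
    have hle : X ≤ (normalizer (S : Set G) ⊓ X) ⊔ OO X r := by
      intro g hg
      obtain ⟨c, hc, hcg⟩ := hS.frattini hs (OO_nz X r hg)
      have h1 : c * g ∈ normalizer (S : Set G) ⊓ X := ⟨hcg, mul_mem (OO_le _ _ hc) hg⟩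
      have : g = c⁻¹ * (c * g) := by group
      rw [this]
      exact mul_mem (le_sup_right (a := normalizer (S : Set G) ⊓ X) (inv_mem hc))
        (le_sup_left (b := OO X r) h1)
    have h2 := card_sup_dvd (A := normalizer (S : Set G) ⊓ X) (N := OO X r)
      (inf_le_right.trans (OO_nz X r))
    have h3 := (card_dvd_of_le ((hQC.trans hCX).trans hle)).trans h2
    obtain ⟨n, hn⟩ := card_pow hr (pp_pg h.nA hr)
    have h4 : Nat.card (pp A r) ∣ Nat.card (normalizer (S : Set G) ⊓ X : Subgroup G) := by
      rw [hn] at h3 ⊢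
      exact (Nat.Coprime.pow_left n ((Nat.Prime.coprime_iff_not_dvd hr).2 hK)).dvd_of_dvd_mul_right h3
    obtain ⟨b, hb, hle⟩ := h.conj_card hr hrA h4
    refine hSb (cj_bot (h.nb hr hrA hs hsB (pg_cj hS.pg b) ?_))
    intro u hu
    have h5 := hle hu
    rw [mem_cj] at h5
    have := nz_cj (a := b) h5.1
    simpa [mul_assoc] using this
  have hCA : C ≤ A := by
    have : Nat.card C ∣ Nat.card (C ⊓ A : Subgroup G) := by
      apply card_dvd_of_syl Nat.card_pos.ne'
      intro t ht htC
      have htA : t ∣ Nat.card A := by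
        have h5 : t ∣ Nat.card (⊤ : Subgroup G) := htC.trans (card_dvd_of_le le_top)
        rw [h.cardG] at h5
        exact (ht.dvd_mul.1 h5).resolve_right fun hB => hXB t ht hB (htC.trans (card_dvd_of_le hCX))
      by_cases htp : t = p
      · subst htp
        exact ⟨P1 ⊓ C, hSX.inf_normal ht hCX (hXJ.trans hJC),
          card_dvd_of_le (le_inf inf_le_right (inf_le_left.trans (hP1A.trans (pp_le _ _))))⟩
      · have h6 : pp A t ≤ C := pp_le_cent h.nA hp ht htp h1
        exact ⟨pp A t, (h.syl ht htA).of_le h6 le_top, card_dvd_of_le (le_inf h6 (pp_le _ _))⟩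
    have h7 := eq_of_le_of_card_ge (inf_le_left : C ⊓ A ≤ C) (Nat.le_of_dvd Nat.card_pos this)
    rw [← h7]; exact inf_le_right
  apply hbad
  intro g hg
  obtain ⟨c, hc, hcg⟩ := (hQ.of_le hQC le_top).frattini hr (hJC hg)
  have := mul_mem (inv_mem (le_normalizer (hCA hc))) (h.nz_pp_le hr hrA hcg)
  simpa using this

lemma Hyp.d (h : Hyp A B) {p : ℕ} (hp : p.Prime) : ∀ (n : ℕ) (P0 : Subgroup G), P0 ≤ pp A p →
    P0 ≠ ⊥ → Nat.card (pp A p) - Nat.card P0 = n →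
    normalizer (P0 : Set G) ≤ normalizer (A : Set G) := by
  intro n
  induction n using Nat.strong_induction_on with
  | _ n ih =>
    intro P0 h1 h0 hn
    apply h.d_step hp h1 h0
    intro P1 hP1 hlt
    have hle := Nat.le_of_dvd Nat.card_pos (card_dvd_of_le hP1)
    refine ih _ ?_ P1 hP1 ?_ rfl
    · omega
    · rintro rfl
      rw [card_bot] at hlt
      have : 0 < Nat.card P0 := Nat.card_pos
      omega

lemma Hyp.card_le (h : Hyp A B) : Nat.card A ≤ Nat.card B := by
  obtain ⟨g, hg⟩ : ∃ g, g ∉ normalizer (A : Set G) := by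
    by_contra! hc
    exact h.NA_ne (top_le_iff.1 fun g _ => hc g)
  have hd : A ⊓ cj g A = ⊥ := by
    by_contra hne
    obtain ⟨p, hp, hpd⟩ := exists_prime_dvd hne
    obtain ⟨x, hx, hxo⟩ := exists_prime_order hp hpd
    have hx1 : x ^ p ^ 1 = 1 := by rw [pow_one, ← hxo, pow_orderOf_eq_one]
    have hxA : x ∈ pp A p := mem_pp' hx.1 ⟨1, hx1⟩
    have hxg : x ∈ cj g (pp A p) := by
      rw [mem_cj]
      refine mem_pp' (mem_cj.1 hx.2) ⟨1, ?_⟩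
      have := pow_conj_eq (g := g⁻¹) hx1
      simpa using this
    have hxne : x ≠ 1 := by
      rintro rfl; rw [orderOf_one] at hxo; exact hp.one_lt.ne hxo
    have h1 : zpowers x ≤ pp A p := by simpa using hxA
    obtain ⟨c, hc, hn⟩ := h.conjN hp (P0 := zpowers x) (g := g) h1 (by simpa using hxg)
    have hc' := h.d hp _ (zpowers x) h1 (by simpa using hxne) rfl (cent_le_nz _ hc)
    apply hg
    have := mul_mem (inv_mem hc') hn
    simpa using this
  have h1 : Nat.card (A × cj g A) ≤ Nat.card G :=
    Nat.card_le_card_of_injective _ (mul_injective_of_disjoint (disjoint_iff.2 hd))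
  rw [Nat.card_prod, card_cj, ← card_top (G := G), h.cardG] at h1
  exact Nat.le_of_mul_le_mul_left h1 Nat.card_pos

theorem Hyp.false (h : Hyp A B) : False := by
  have e := le_antisymm h.card_le h.symm.card_le
  have hc := h.cop
  rw [← e, Nat.coprime_self] at hc
  exact h.A_bot (card_eq_one.1 hc)

end main7
end KW

set_option linter.all false
namespace KW
open Polynomial

lemma norm_one_of_pow {z : ℂ} {m : ℕ} (hm : 0 < m) (h : z ^ m = 1) : ‖z‖ = 1 :=
  Complex.norm_eq_one_of_pow_eq_one h hm.ne'

lemma integral_of_pow {z : ℂ} {R : Type*} [CommRing R] [Algebra R ℂ] {m : ℕ} (hm : 0 < m)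
    (h : z ^ m = 1) : IsIntegral R z :=
  IsIntegral.of_pow hm (h ▸ isIntegral_one)

lemma avg_fin {ι : Type*} [Fintype ι] [Nonempty ι] (f : ι → ℂ) {m : ℕ} (hm : 0 < m)
    (hf : ∀ i, f i ^ m = 1) {a : ℂ} (ha : (Fintype.card ι : ℂ) * a = ∑ i, f i)
    (haint : IsIntegral ℤ a) (h0 : a ≠ 0) (i : ι) : f i = a := by
  have hcard : (0 : ℝ) < Fintype.card ι := by exact_mod_cast Fintype.card_pos
  have hcardC : (Fintype.card ι : ℂ) ≠ 0 := by exact_mod_cast Fintype.card_pos.ne'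
  let K := IntermediateField.adjoin ℚ (Set.range f)
  haveI : FiniteDimensional ℚ K := by
    apply IntermediateField.finiteDimensional_adjoin
    rintro _ ⟨i, rfl⟩
    exact integral_of_pow hm (hf i)
  haveI : NumberField K := { to_charZero := inferInstance, to_finiteDimensional := this }
  have hfK : ∀ i, f i ∈ K := fun i => IntermediateField.subset_adjoin _ _ ⟨i, rfl⟩
  have haK : a ∈ K := by
    have : a = (∑ i, f i) * (Fintype.card ι : ℂ)⁻¹ := by rw [← ha]; field_simp
    rw [this]
    exact mul_mem (sum_mem fun i _ => hfK i) (inv_mem (natCast_mem K _))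
  let x : K := ⟨a, haK⟩
  let F : ι → K := fun i => ⟨f i, hfK i⟩
  have hx : (Fintype.card ι : K) * x = ∑ i, F i := by
    apply Subtype.ext
    simp [x, F, ha]
  have hF : ∀ i, F i ^ m = 1 := fun i => Subtype.ext (by simpa [F] using hf i)
  have hxi : IsIntegral ℤ x := by
    have : Function.Injective (algebraMap K ℂ) := (algebraMap K ℂ).injective
    exact (isIntegral_algebraMap_iff this).1 haint
  obtain ⟨n, hn, hxn⟩ := NumberField.Embeddings.pow_eq_one_of_norm_le_one K ℂ (x := x)
    (fun e => h0 (congrArg Subtype.val e)) hxi (by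
      intro φ
      have h1 : (Fintype.card ι : ℂ) * φ x = ∑ i, φ (F i) := by
        rw [← map_sum, ← hx]; simp
      have h2 : ∀ i, ‖φ (F i)‖ = 1 := fun i =>
        norm_one_of_pow hm (by rw [← map_pow, hF, map_one])
      have h3 : ‖(Fintype.card ι : ℂ) * φ x‖ ≤ Fintype.card ι := by
        rw [h1]
        refine (norm_sum_le _ _).trans ?_
        simp [h2]
      rw [norm_mul, Complex.norm_natCast] at h3
      nlinarith)
  have han : ‖a‖ = 1 := norm_one_of_pow hn (by simpa [x] using congrArg Subtype.val hxn)
  have haa : a * (starRingEnd ℂ) a = 1 := by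
    rw [Complex.mul_conj, Complex.normSq_eq_norm_sq, han]; simp
  have hle : ∀ i, (f i * (starRingEnd ℂ) a).re ≤ 1 := fun i => by
    refine (Complex.re_le_norm _).trans ?_
    rw [norm_mul, norm_one_of_pow hm (hf i), RCLike.norm_conj, han]; simp
  have hsum : ∑ i, (1 - (f i * (starRingEnd ℂ) a).re) = 0 := by
    rw [Finset.sum_sub_distrib, ← Complex.re_sum, ← Finset.sum_mul, ← ha, mul_assoc, haa]
    simp
  have hi := (Finset.sum_eq_zero_iff_of_nonneg (fun i _ => sub_nonneg.2 (hle i))).1 hsum i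
    (Finset.mem_univ i)
  have hn1 : ‖f i * (starRingEnd ℂ) a‖ = 1 := by
    rw [norm_mul, norm_one_of_pow hm (hf i), RCLike.norm_conj, han]; simp
  have hre : (f i * (starRingEnd ℂ) a).re = 1 := by linarith
  have him : (f i * (starRingEnd ℂ) a).im = 0 := by
    have := Complex.sq_norm (f i * (starRingEnd ℂ) a)
    rw [hn1, Complex.normSq_apply, hre] at this
    nlinarith
  have h1 : f i * (starRingEnd ℂ) a = 1 := Complex.ext (by simpa using hre) (by simpa using him)
  calc f i = f i * (a * (starRingEnd ℂ) a) := by rw [haa, mul_one]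
    _ = (f i * (starRingEnd ℂ) a) * a := by ring
    _ = a := by rw [h1, one_mul]

lemma avg_multiset (s : Multiset ℂ) {m : ℕ} (hm : 0 < m) (hs : ∀ z ∈ s, z ^ m = 1) {a : ℂ}
    (ha : (s.card : ℂ) * a = s.sum) (haint : IsIntegral ℤ a) (h0 : a ≠ 0) : ∀ z ∈ s, z = a := by
  induction s using Quotient.inductionOn with
  | _ l =>
    intro z hz
    obtain ⟨i, rfl⟩ := List.get_of_mem (show z ∈ l from hz)
    haveI : Nonempty (Fin l.length) := ⟨i⟩
    refine avg_fin (fun i => l.get i) hm (fun i => hs _ (List.get_mem l i)) ?_ haint h0 i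
    have h1 : ∑ i, l.get i = l.sum := by simp [Fin.sum_univ_getElem]
    rw [h1]
    simpa using ha

lemma pow_of_root {n : ℕ} {M : Matrix (Fin n) (Fin n) ℂ} {m : ℕ} (hM : M ^ m = 1) (hn : n ≠ 0)
    {z : ℂ} (hz : z ∈ M.charpoly.roots) : z ^ m = 1 := by
  haveI : NeZero n := ⟨hn⟩
  have h1 := Matrix.mem_spectrum_iff_isRoot_charpoly.2 (isRoot_of_mem_roots hz)
  have h2 := spectrum.pow_mem_pow M m h1
  rw [hM, spectrum.one_eq] at h2
  simpa using h2

lemma card_roots_charpoly {n : ℕ} (M : Matrix (Fin n) (Fin n) ℂ) : M.charpoly.roots.card = n := by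
  rw [IsAlgClosed.card_roots_eq_natDegree]
  simp

lemma trace_integral {n : ℕ} {M : Matrix (Fin n) (Fin n) ℂ} {m : ℕ} (hm : 0 < m) (hM : M ^ m = 1)
    (hn : n ≠ 0) : IsIntegral ℤ M.trace := by
  rw [Matrix.trace_eq_sum_roots_charpoly]
  exact IsIntegral.multiset_sum fun z hz => integral_of_pow hm (pow_of_root hM hn hz)

lemma scalar_of_integral {n : ℕ} {M : Matrix (Fin n) (Fin n) ℂ} {m : ℕ} (hm : 0 < m)
    (hM : M ^ m = 1) (hn : n ≠ 0) {a : ℂ} (ha : (n : ℂ) * a = M.trace) (haint : IsIntegral ℤ a)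
    (h0 : a ≠ 0) : M = algebraMap ℂ _ a := by
  have h1 : ∀ z ∈ M.charpoly.roots, z = a := by
    apply avg_multiset _ hm (fun z hz => pow_of_root hM hn hz) _ haint h0
    rw [card_roots_charpoly, ← Matrix.trace_eq_sum_roots_charpoly, ha]
  have h2 : M.charpoly = (X - C a) ^ n := by
    have h3 := (IsAlgClosed.splits M.charpoly).eq_prod_roots_of_monic (Matrix.charpoly_monic M)
    rw [Multiset.eq_replicate.2 ⟨card_roots_charpoly M, h1⟩] at h3
    simpa using h3
  have ham : a ^ m = 1 := by
    have : a ∈ M.charpoly.roots := by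
      rw [Multiset.eq_replicate.2 ⟨card_roots_charpoly M, h1⟩]
      exact Multiset.mem_replicate.2 ⟨hn, rfl⟩
    exact pow_of_root hM hn this
  obtain ⟨g, hg⟩ : (X - C a) ∣ (X ^ m - 1 : ℂ[X]) := by
    rw [dvd_iff_isRoot]; simp [ham]
  have hga : ¬ g.IsRoot a := by
    intro hr
    have := congrArg (fun p => (derivative p).eval a) hg
    simp only [derivative_sub, derivative_one, derivative_mul, derivative_X, derivative_C,
      derivative_X_pow, eval_add, eval_mul, eval_sub, eval_X, eval_C, eval_one, eval_zero,
      eval_pow, eval_natCast, hr.eq_zero] at this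
    have h5 : (m : ℂ) * a ^ (m - 1) = 0 := by simpa using this
    rcases mul_eq_zero.1 h5 with h | h
    · exact hm.ne' (by exact_mod_cast h)
    · exact h0 (eq_zero_of_pow_eq_zero h)
  have hcop : IsCoprime g ((X - C a) ^ n) := by
    apply IsCoprime.pow_right
    apply IsCoprime.symm
    exact (irreducible_X_sub_C a).coprime_iff_not_dvd.2 fun hd => hga (dvd_iff_isRoot.1 hd)
  obtain ⟨u, v, huv⟩ := hcop
  have e1 := congrArg (aeval M) huv
  rw [← h2, map_add, map_mul, map_mul, Matrix.aeval_self_charpoly, mul_zero, add_zero, map_one] at e1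
  have e2 := congrArg (aeval M) hg
  rw [mul_comm] at e2
  simp only [map_sub, map_mul, map_pow, aeval_X, map_one, hM, sub_self, aeval_C] at e2
  have e3 : M - algebraMap ℂ _ a = 0 := by
    calc M - algebraMap ℂ _ a = (aeval M u * aeval M g) * (M - algebraMap ℂ _ a) := by rw [e1, one_mul]
      _ = aeval M u * (aeval M g * (M - algebraMap ℂ _ a)) := by rw [mul_assoc]
      _ = 0 := by rw [← e2, mul_zero]
  exact sub_eq_zero.1 e3

end KW

set_option linter.all false
namespace KW
open MonoidAlgebra

lemma trace_pi {N : ℕ} {d : Fin N → ℕ} (x : Π i, Matrix (Fin (d i)) (Fin (d i)) ℂ) :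
    LinearMap.trace ℂ _ (LinearMap.mulLeft ℂ x) = ∑ i, (d i : ℂ) * (x i).trace := by
  classical
  rw [LinearMap.trace_eq_matrix_trace ℂ
    (Pi.basis (fun i => Matrix.stdBasis ℂ (Fin (d i)) (Fin (d i))))]
  simp only [Matrix.trace, Matrix.diag, LinearMap.toMatrix_apply]
  rw [Fintype.sum_sigma]
  apply Finset.sum_congr rfl
  intro i _
  rw [Fintype.sum_prod_type]
  have : ∀ a b : Fin (d i), ((Pi.basis (fun i => Matrix.stdBasis ℂ (Fin (d i)) (Fin (d i)))).repr
      (LinearMap.mulLeft ℂ x ((Pi.basis (fun i => Matrix.stdBasis ℂ (Fin (d i)) (Fin (d i)))) ⟨i, a, b⟩)))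
      ⟨i, a, b⟩ = x i a a := by
    intro a b
    rw [Pi.basis_repr, LinearMap.mulLeft_apply, Pi.mul_apply, Pi.basis_apply, Pi.single_eq_same,
      Matrix.stdBasis_eq_single]
    have : ∀ M : Matrix (Fin (d i)) (Fin (d i)) ℂ, (Matrix.stdBasis ℂ (Fin (d i)) (Fin (d i))).repr M (a, b) = M a b := by
      intro M; rfl
    rw [this]
    simp
  simp only [this]
  simp [Finset.mul_sum]

variable {G : Type*} [Group G]

lemma trace_grp [Finite G] {g : G} (hg : g ≠ 1) :
    LinearMap.trace ℂ (MonoidAlgebra ℂ G) (LinearMap.mulLeft ℂ (of ℂ G g)) = 0 := by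
  classical
  haveI := Fintype.ofFinite G
  rw [LinearMap.trace_eq_matrix_trace ℂ (MonoidAlgebra.basis G ℂ)]
  simp only [Matrix.trace, Matrix.diag, LinearMap.toMatrix_apply]
  apply Finset.sum_eq_zero
  intro h _
  simp [MonoidAlgebra.basis, hg]

lemma scalar_of_comm {n : ℕ} (φ : MonoidAlgebra ℂ G →ₐ[ℂ] Matrix (Fin n) (Fin n) ℂ)
    (hφ : Function.Surjective φ) {M : Matrix (Fin n) (Fin n) ℂ}
    (ha : ∀ h, φ (of ℂ G h) * M = M * φ (of ℂ G h)) : ∃ c : ℂ, M = algebraMap ℂ _ c := by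
  have h1 : ∀ x, φ x * M = M * φ x := by
    intro x
    induction x using MonoidAlgebra.induction_on with
    | of h => exact ha h
    | add x y hx hy => rw [map_add, add_mul, mul_add, hx, hy]
    | smul c x hx => rw [map_smul, smul_mul_assoc, hx, mul_smul_comm]
  have h2 : M ∈ Set.center (Matrix (Fin n) (Fin n) ℂ) := by
    rw [Semigroup.mem_center_iff]
    intro y
    obtain ⟨x, rfl⟩ := hφ y
    exact h1 x
  rw [Matrix.center_eq_range] at h2
  obtain ⟨c, hc⟩ := h2
  exact ⟨c, hc.symm⟩

lemma int_of_sum (S : Finset G) [Finite G] : IsIntegral ℤ (∑ x ∈ S, of ℂ G x) := by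
  haveI : Module.Finite ℤ (MonoidAlgebra ℤ G) := Module.Finite.of_basis (MonoidAlgebra.basis G ℤ)
  have h1 : IsIntegral ℤ (∑ x ∈ S, of ℤ G x) := (Algebra.IsIntegral.of_finite ℤ _).isIntegral _
  have h2 := h1.map (MonoidAlgebra.mapRingHom G (Int.castRingHom ℂ)).toIntAlgHom
  simpa using h2

lemma comp_class [Finite G] {n : ℕ} (hn : n ≠ 0)
    (φ : MonoidAlgebra ℂ G →ₐ[ℂ] Matrix (Fin n) (Fin n) ℂ) (hφ : Function.Surjective φ) {g : G}
    (S : Finset G) (hS : ∀ x, x ∈ S ↔ IsConj g x) {q k : ℕ} (hq : q.Prime) (hc : S.card = q ^ k)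
    (hqn : ¬ q ∣ n) : (φ (of ℂ G g)).trace = 0 ∨ ∃ c : ℂ, φ (of ℂ G g) = algebraMap ℂ _ c := by
  classical
  haveI : NeZero n := ⟨hn⟩
  have hcomm : ∀ h, φ (of ℂ G h) * φ (∑ x ∈ S, of ℂ G x) = φ (∑ x ∈ S, of ℂ G x) * φ (of ℂ G h) := by
    intro h
    rw [← map_mul, ← map_mul, Finset.mul_sum, Finset.sum_mul]
    congr 1
    refine Finset.sum_bij' (fun x _ => h * x * h⁻¹) (fun x _ => h⁻¹ * x * h) ?_ ?_ ?_ ?_ ?_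
    · intro x hx
      rw [hS] at hx ⊢
      exact hx.trans (isConj_iff.2 ⟨h, rfl⟩)
    · intro x hx
      rw [hS] at hx ⊢
      exact hx.trans (isConj_iff.2 ⟨h⁻¹, by simp⟩)
    · intro x _; group
    · intro x _; group
    · intro x _
      rw [← map_mul, ← map_mul]; simp
  obtain ⟨c, hcs⟩ := scalar_of_comm φ hφ hcomm
  have hcint : IsIntegral ℤ c := by
    have h1 := (int_of_sum S).map (φ.restrictScalars ℤ)
    have h2 : (φ.restrictScalars ℤ) (∑ x ∈ S, of ℂ G x) = algebraMap ℂ _ c := hcs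
    rw [h2] at h1
    exact (isIntegral_algebraMap_iff (FaithfulSMul.algebraMap_injective ℂ _)).1 h1
  have htr : (n : ℂ) * c = (S.card : ℂ) * (φ (of ℂ G g)).trace := by
    have h1 := congrArg Matrix.trace hcs
    have h3 : ∀ x ∈ S, (φ (of ℂ G x)).trace = (φ (of ℂ G g)).trace := by
      intro x hx
      obtain ⟨h, rfl⟩ := isConj_iff.1 ((hS x).1 hx)
      rw [map_mul, map_mul, map_mul, map_mul, Matrix.trace_mul_comm, ← mul_assoc, ← map_mul φ,
        ← map_mul (of ℂ G), inv_mul_cancel, map_one (of ℂ G), map_one φ, one_mul]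
    rw [map_sum, Matrix.trace_sum, Finset.sum_congr rfl h3, Finset.sum_const, nsmul_eq_mul,
      Matrix.algebraMap_eq_diagonal, Matrix.trace_diagonal] at h1
    rw [h1]; simp
  have hpow : φ (of ℂ G g) ^ Nat.card G = 1 := by
    rw [← map_pow, ← map_pow, pow_card_eq_one', map_one, map_one]
  have hχ := trace_integral Nat.card_pos hpow hn
  have hcop : Nat.Coprime S.card n := by
    rw [hc]; exact Nat.Coprime.pow_left k ((Nat.Prime.coprime_iff_not_dvd hq).2 hqn)
  obtain ⟨u, v, huv⟩ := Nat.isCoprime_iff_coprime.2 hcop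
  have huv' : (u : ℂ) * S.card + v * n = 1 := by exact_mod_cast huv
  set χ := (φ (of ℂ G g)).trace with hχd
  have hu : IsIntegral ℤ ((u : ℤ) : ℂ) := by simpa using isIntegral_algebraMap (R := ℤ) (A := ℂ) (x := u)
  have hv : IsIntegral ℤ ((v : ℤ) : ℂ) := by simpa using isIntegral_algebraMap (R := ℤ) (A := ℂ) (x := v)
  have ha : IsIntegral ℤ ((u : ℂ) * c + v * χ) := (hu.mul hcint).add (hv.mul hχ)
  have hna : (n : ℂ) * ((u : ℂ) * c + v * χ) = χ := by
    linear_combination (u : ℂ) * htr + χ * huv'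
  by_cases h0 : (u : ℂ) * c + v * χ = 0
  · left; rw [← hna, h0, mul_zero]
  · right
    exact ⟨_, scalar_of_integral Nat.card_pos hpow hn hna ha h0⟩

lemma triv_scalar {n : ℕ} (φ : MonoidAlgebra ℂ G →ₐ[ℂ] Matrix (Fin n) (Fin n) ℂ)
    (h : ∀ g, φ (of ℂ G g) = 1) (x : MonoidAlgebra ℂ G) :
    φ x = algebraMap ℂ _ (MonoidAlgebra.lift ℂ ℂ G 1 x) := by
  have : φ = (Algebra.ofId ℂ _).comp (MonoidAlgebra.lift ℂ ℂ G 1) := by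
    apply MonoidAlgebra.algHom_ext
    · intro g
      have := h g
      simp only [of_apply] at this
      rw [this]
      simp
    · exact Subsingleton.elim _ _
  conv_lhs => rw [this]
  rfl

lemma not_int {q : ℕ} (hq : q.Prime) {b : ℂ} (hb : IsIntegral ℤ b) (h : 1 + (q : ℂ) * b = 0) :
    False := by
  have hq0 : (q : ℂ) ≠ 0 := by exact_mod_cast hq.ne_zero
  have hq0' : (q : ℚ) ≠ 0 := by exact_mod_cast hq.ne_zero
  have e : b = algebraMap ℚ ℂ (-(q : ℚ)⁻¹) := by
    have : b = -(q : ℂ)⁻¹ := by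
      field_simp
      linear_combination h
    rw [this]; simp
  rw [e, isIntegral_algebraMap_iff (algebraMap ℚ ℂ).injective] at hb
  obtain ⟨y, hy⟩ := IsIntegrallyClosed.isIntegral_iff.1 hb
  have h1 : (y : ℚ) * q = -1 := by
    have : (y : ℚ) = -(q : ℚ)⁻¹ := by simpa using hy
    rw [this]; field_simp
  have h2 : y * q = -1 := by exact_mod_cast h1
  have h3 : (q : ℤ) ∣ 1 := ⟨-y, by linarith⟩
  have h4 : q ∣ 1 := by exact_mod_cast h3
  exact hq.one_lt.ne' (Nat.dvd_one.1 h4)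

theorem burnside_class [Finite G] (hs : ∀ N : Subgroup G, N.Normal → N = ⊥ ∨ N = ⊤)
    (hns : ¬ Group.IsSolvable G) {g : G} (hg : g ≠ 1) (S : Finset G)
    (hS : ∀ x, x ∈ S ↔ IsConj g x) {q k : ℕ} (hq : q.Prime) (hc : S.card = q ^ k) : False := by
  classical
  haveI := Fintype.ofFinite G
  haveI : FiniteDimensional ℂ (MonoidAlgebra ℂ G) := Module.Finite.of_basis (MonoidAlgebra.basis G ℂ)
  obtain ⟨N, d, hd, ⟨e⟩⟩ :=
    IsSemisimpleRing.exists_algEquiv_pi_matrix_of_isAlgClosed ℂ (MonoidAlgebra ℂ G)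
  have hd0 : ∀ i, d i ≠ 0 := fun i => (hd i).out
  let φ : ∀ i, MonoidAlgebra ℂ G →ₐ[ℂ] Matrix (Fin (d i)) (Fin (d i)) ℂ := fun i =>
    (Pi.evalAlgHom ℂ _ i).comp e.toAlgHom
  have hφe : ∀ i x, φ i x = e x i := fun i x => rfl
  have hφ : ∀ i, Function.Surjective (φ i) := by
    intro i y
    refine ⟨e.symm (Pi.single i y), ?_⟩
    rw [hφe]; simp
  -- the regular character
  have htrace : ∑ i, (d i : ℂ) * (φ i (of ℂ G g)).trace = 0 := by
    have h1 := trace_pi (e (of ℂ G g))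
    simp_rw [hφe]
    rw [← trace_grp hg, ← LinearMap.trace_conj' _ e.toLinearEquiv, ← h1]
    congr 1
    refine LinearMap.ext fun x => ?_
    change e (of ℂ G g) * x = e (of ℂ G g * e.symm x)
    rw [map_mul, AlgEquiv.apply_symm_apply]
  -- the trivial component
  obtain ⟨i0, hi0⟩ : ∃ i, φ i (∑ h : G, of ℂ G h) ≠ 0 := by
    by_contra! hcon
    have h1 : e (∑ h : G, of ℂ G h) = 0 := funext hcon
    rw [map_eq_zero_iff e e.injective] at h1
    have h2 := congrArg (MonoidAlgebra.lift ℂ ℂ G 1) h1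
    simp at h2
  have hleft : ∀ h, of ℂ G h * (∑ h : G, of ℂ G h) = ∑ h : G, of ℂ G h := by
    intro h
    rw [Finset.mul_sum]
    simp_rw [← map_mul]
    exact Fintype.sum_equiv (Equiv.mulLeft h) _ _ fun x => rfl
  have hright : ∀ h, (∑ h : G, of ℂ G h) * of ℂ G h = ∑ h : G, of ℂ G h := by
    intro h
    rw [Finset.sum_mul]
    simp_rw [← map_mul]
    exact Fintype.sum_equiv (Equiv.mulRight h) _ _ fun x => rfl
  have htriv : ∀ h, φ i0 (of ℂ G h) = 1 := by
    obtain ⟨c, hcs⟩ := scalar_of_comm (φ i0) (hφ i0) (M := φ i0 (∑ h : G, of ℂ G h)) (fun h => by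
      rw [← map_mul, ← map_mul, hleft, hright])
    intro h
    have h1 := congrArg (φ i0) (hleft h)
    rw [map_mul, hcs] at h1
    have hc0 : c ≠ 0 := by
      rintro rfl; rw [hcs, map_zero] at hi0; exact hi0 rfl
    rw [Algebra.algebraMap_eq_smul_one, mul_smul_comm, mul_one] at h1
    exact smul_right_injective _ hc0 h1
  have hd1 : d i0 = 1 := by
    by_contra hne
    have h2 : 1 < d i0 := by have := hd0 i0; omega
    obtain ⟨x, hx⟩ := hφ i0 (Matrix.single ⟨0, by omega⟩ ⟨1, h2⟩ 1)
    rw [triv_scalar _ htriv, Matrix.algebraMap_eq_diagonal] at hx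
    have := congrFun (congrFun hx ⟨0, by omega⟩) ⟨1, h2⟩
    simp at this
  have hterm : ∀ i, i ≠ i0 → ∃ b, IsIntegral ℤ b ∧ (d i : ℂ) * (φ i (of ℂ G g)).trace = q * b := by
    intro i hi
    by_cases hqd : q ∣ d i
    · obtain ⟨m, hm⟩ := hqd
      have hpow : φ i (of ℂ G g) ^ Nat.card G = 1 := by
        rw [← map_pow, ← map_pow, pow_card_eq_one', map_one, map_one]
      have hm' : IsIntegral ℤ ((m : ℕ) : ℂ) := by
        simpa using isIntegral_algebraMap (R := ℤ) (A := ℂ) (x := m)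
      refine ⟨m * (φ i (of ℂ G g)).trace,
        hm'.mul (trace_integral Nat.card_pos hpow (hd0 i)), ?_⟩
      have : (d i : ℂ) = q * m := by rw [hm]; push_cast; rfl
      rw [this, mul_assoc]
    · rcases comp_class (hd0 i) (φ i) (hφ i) S hS hq hc hqd with h0 | ⟨c, hsc⟩
      · exact ⟨0, isIntegral_zero, by rw [h0]; simp⟩
      · exfalso
        let ρ : G →* Matrix (Fin (d i)) (Fin (d i)) ℂ := ((φ i : _ →* _)).comp (of ℂ G)
        have hρ : ∀ h, ρ h = φ i (of ℂ G h) := fun h => rfl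
        rcases hs ρ.ker inferInstance with hk | hk
        · have hgc : g ∈ Subgroup.center G := by
            rw [Subgroup.mem_center_iff]
            intro h
            have h1 : h * g * (g * h)⁻¹ ∈ ρ.ker := by
              rw [MonoidHom.mem_ker]
              have : ρ (h * g) = ρ (g * h) := by
                rw [map_mul, map_mul, hρ g, hsc]
                exact (Algebra.commutes c (ρ h)).symm
              rw [map_mul, this, ← map_mul, mul_inv_cancel, map_one]
            rw [hk, Subgroup.mem_bot] at h1
            exact mul_inv_eq_one.1 h1
          rcases hs (Subgroup.center G) inferInstance with hz | hz
          · rw [hz, Subgroup.mem_bot] at hgc; exact hg hgc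
          · apply hns
            apply Group.isSolvable_of_comm
            intro a b
            have : a ∈ Subgroup.center G := by rw [hz]; trivial
            exact (Subgroup.mem_center_iff.1 this b).symm
        · have ht : ∀ h, φ i (of ℂ G h) = 1 := by
            intro h
            have : h ∈ ρ.ker := by rw [hk]; trivial
            exact this
          haveI := hd i
          haveI := hd i0
          have h1 := triv_scalar _ ht (e.symm (Pi.single i0 1))
          have h2 := triv_scalar _ htriv (e.symm (Pi.single i0 1))
          rw [hφe, AlgEquiv.apply_symm_apply, Pi.single_eq_of_ne hi] at h1
          rw [hφe, AlgEquiv.apply_symm_apply, Pi.single_eq_same] at h2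
          have h3 := (map_eq_zero_iff _ (FaithfulSMul.algebraMap_injective ℂ
            (Matrix (Fin (d i)) (Fin (d i)) ℂ))).1 h1.symm
          rw [h3, map_zero] at h2
          exact one_ne_zero h2
  choose! b hb1 hb2 using hterm
  rw [← Finset.add_sum_erase _ _ (Finset.mem_univ i0), htriv, hd1] at htrace
  rw [Finset.sum_congr rfl (fun i hi => hb2 i (Finset.ne_of_mem_erase hi)), ← Finset.mul_sum,
    Matrix.trace_one] at htrace
  have haint : IsIntegral ℤ (∑ i ∈ Finset.univ.erase i0, b i) :=
    IsIntegral.sum _ fun i hi => hb1 i (Finset.ne_of_mem_erase hi)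
  refine not_int hq haint ?_
  rw [← htrace]
  simp only [Fintype.card_fin, Nat.cast_one, mul_one]

end KW

set_option linter.all false
namespace KW
open Subgroup

section kegel
variable {G : Type*} [Group G] [Finite G]

open scoped Pointwise in
lemma card_prod_set (S B : Subgroup G) :
    Nat.card S * Nat.card B = Nat.card ((S : Set G) * (B : Set G) : Set G) *
      Nat.card (S ⊓ B : Subgroup G) := by
  have hz : ∀ z : ((S : Set G) * (B : Set G) : Set G), ∃ s ∈ S, ∃ b ∈ B, s * b = (z : G) := by
    rintro ⟨z, hz⟩
    obtain ⟨s, hs, b, hb, e⟩ := Set.mem_mul.1 hz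
    exact ⟨s, hs, b, hb, e⟩
  choose s hs b hb e using hz
  rw [← Nat.card_prod, ← Nat.card_prod]
  symm
  apply Nat.card_congr
  refine Equiv.ofBijective (fun x => ((⟨s x.1 * x.2, S.mul_mem (hs _) x.2.2.1⟩ : S),
    (⟨(x.2 : G)⁻¹ * b x.1, B.mul_mem (B.inv_mem x.2.2.2) (hb _)⟩ : B))) ⟨?_, ?_⟩
  · rintro ⟨z, d⟩ ⟨z', d'⟩ h
    simp only [Prod.mk.injEq, Subtype.mk.injEq] at h
    have h1 : (z : G) = z' := by
      rw [← e z, ← e z']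
      calc s z * b z = (s z * d) * ((d : G)⁻¹ * b z) := by group
        _ = (s z' * d') * ((d' : G)⁻¹ * b z') := by rw [h.1, h.2]
        _ = _ := by group
    obtain rfl := Subtype.ext h1
    have := mul_left_cancel h.1
    rw [Subtype.ext this]
  · rintro ⟨⟨x, hx⟩, ⟨y, hy⟩⟩
    let z : ((S : Set G) * (B : Set G) : Set G) := ⟨x * y, Set.mul_mem_mul hx hy⟩
    have ez : s z * b z = x * y := e z
    have h1 : (s z)⁻¹ * x = b z * y⁻¹ := by
      rw [inv_mul_eq_iff_eq_mul, ← mul_assoc, ez]; group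
    refine ⟨(z, ⟨(s z)⁻¹ * x, S.mul_mem (S.inv_mem (hs _)) hx,
      h1 ▸ B.mul_mem (hb _) (B.inv_mem hy)⟩), ?_⟩
    simp only [Prod.mk.injEq, Subtype.mk.injEq]
    constructor
    · group
    · rw [h1]; group

/-- permutability -/
def PM (S B : Subgroup G) : Prop := ∀ x ∈ S, ∀ y ∈ B, ∃ y' ∈ B, ∃ x' ∈ S, x * y = y' * x'

lemma PM.symm {S B : Subgroup G} (h : PM S B) : PM B S := by
  intro x hx y hy
  obtain ⟨y', hy', x', hx', e⟩ := h y⁻¹ (S.inv_mem hy) x⁻¹ (B.inv_mem hx)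
  refine ⟨x'⁻¹, S.inv_mem hx', y'⁻¹, B.inv_mem hy', ?_⟩
  rw [← mul_inv_rev, ← e]; group

lemma PM.cj {S B : Subgroup G} (h : PM S B) (g : G) : PM (cj g S) (cj g B) := by
  intro x hx y hy
  obtain ⟨y', hy', x', hx', e⟩ := h _ (mem_cj.1 hx) _ (mem_cj.1 hy)
  refine ⟨g * y' * g⁻¹, conj_mem_cj hy', g * x' * g⁻¹, conj_mem_cj hx', ?_⟩
  calc x * y = g * ((g⁻¹ * x * g) * (g⁻¹ * y * g)) * g⁻¹ := by group
    _ = _ := by rw [e]; group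

lemma PM.sup {S T B : Subgroup G} (hS : PM S B) (hT : PM T B) : PM (S ⊔ T) B := by
  intro x hx
  rw [sup_eq_closure] at hx
  have key : ∀ x ∈ (S : Set G) ∪ T, ∀ z, (∀ y ∈ B, ∃ y' ∈ B, ∃ x' ∈ S ⊔ T, z * y = y' * x') →
      (∀ y ∈ B, ∃ y' ∈ B, ∃ x' ∈ S ⊔ T, x * z * y = y' * x') := by
    intro x hx z hz y hy
    obtain ⟨y', hy', x', hx', e⟩ := hz y hy
    have : ∃ y'' ∈ B, ∃ x'' ∈ S ⊔ T, x * y' = y'' * x'' := by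
      rcases hx with hx | hx
      · obtain ⟨a, ha, b, hb, e⟩ := hS x hx y' hy'
        exact ⟨a, ha, b, (le_sup_left : S ≤ S ⊔ T) hb, e⟩
      · obtain ⟨a, ha, b, hb, e⟩ := hT x hx y' hy'
        exact ⟨a, ha, b, (le_sup_right : T ≤ S ⊔ T) hb, e⟩
    obtain ⟨y'', hy'', x'', hx'', e'⟩ := this
    refine ⟨y'', hy'', x'' * x', mul_mem hx'' hx', ?_⟩
    rw [mul_assoc, e, ← mul_assoc, e', mul_assoc]
  induction hx using Subgroup.closure_induction_left with
  | one => exact fun y hy => ⟨y, hy, 1, one_mem _, by simp⟩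
  | mul_left x hx y hy ih => exact key x hx y ih
  | inv_mul_cancel x hx y hy ih =>
    refine key x⁻¹ ?_ y ih
    rcases hx with hx | hx
    · exact Or.inl (S.inv_mem hx)
    · exact Or.inr (T.inv_mem hx)

lemma PM.mem_sup {S B : Subgroup G} (h : PM S B) {x : G} (hx : x ∈ S ⊔ B) :
    ∃ s ∈ S, ∃ b ∈ B, x = s * b := by
  rw [sup_eq_closure] at hx
  have key : ∀ x ∈ (S : Set G) ∪ B, ∀ z, (∃ s ∈ S, ∃ b ∈ B, z = s * b) →
      (∃ s ∈ S, ∃ b ∈ B, x * z = s * b) := by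
    rintro x hx z ⟨s, hs, b, hb, rfl⟩
    rcases hx with hx | hx
    · exact ⟨x * s, S.mul_mem hx hs, b, hb, by rw [mul_assoc]⟩
    · obtain ⟨s', hs', b', hb', e⟩ := h.symm x hx s hs
      exact ⟨s', hs', b' * b, B.mul_mem hb' hb, by rw [← mul_assoc, e, mul_assoc]⟩
  induction hx using Subgroup.closure_induction_left with
  | one => exact ⟨1, one_mem _, 1, one_mem _, by simp⟩
  | mul_left x hx y hy ih => exact key x hx y ih
  | inv_mul_cancel x hx y hy ih =>
    refine key x⁻¹ ?_ y ih
    rcases hx with hx | hx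
    · exact Or.inl (S.inv_mem hx)
    · exact Or.inr (B.inv_mem hx)

open scoped Pointwise in
lemma PM.pg {p : ℕ} (hp : p.Prime) {S B : Subgroup G} (h : PM S B) (hS : IsPGroup p S)
    (hB : IsPGroup p B) : IsPGroup p (S ⊔ B : Subgroup G) := by
  haveI : Fact p.Prime := ⟨hp⟩
  have e : ((S ⊔ B : Subgroup G) : Set G) = (S : Set G) * (B : Set G) := by
    ext x
    constructor
    · intro hx
      obtain ⟨s, hs, b, hb, rfl⟩ := h.mem_sup hx
      exact Set.mul_mem_mul hs hb
    · rintro ⟨s, hs, b, hb, rfl⟩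
      exact mul_mem_sup hs hb
  have h1 := card_prod_set S B
  rw [← e] at h1
  obtain ⟨m, hm⟩ := card_pow hp hS
  obtain ⟨n, hn⟩ := card_pow hp hB
  have h2 : Nat.card (S ⊔ B : Subgroup G) ∣ p ^ (m + n) := by
    rw [pow_add, ← hm, ← hn, h1]; exact Dvd.intro _ rfl
  obtain ⟨k, -, hk⟩ := (Nat.dvd_prime_pow hp).1 h2
  exact IsPGroup.of_card hk

structure Mn (A B : Subgroup G) : Prop where
  nA : Group.IsNilpotent A
  nB : Group.IsNilpotent B
  fact : ∀ g : G, ∃ a ∈ A, ∃ b ∈ B, g = a * b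
  nsol : ¬ Group.IsSolvable G
  sub : ∀ H : Subgroup G, H ≠ ⊤ → Fz A B H → Group.IsSolvable H
  quo : ∀ N : Subgroup G, [N.Normal] → N ≠ ⊥ → Group.IsSolvable (G ⧸ N)

variable {A B : Subgroup G}

lemma Mn.no_sol (h : Mn A B) {N : Subgroup G} (hN : N.Normal) (hs : Group.IsSolvable N) :
    N = ⊥ := by
  by_contra hne
  exact h.nsol ((Group.isSolvable_iff_subgroup_quotient N).2 ⟨hs, h.quo N hne⟩)

lemma sol_of_comm {N : Subgroup G} (h : ∀ x ∈ N, ∀ y ∈ N, x * y = y * x) :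
    Group.IsSolvable N :=
  Group.isSolvable_of_comm fun a b => Subtype.ext (h a a.2 b b.2)

lemma Mn.inter (h : Mn A B) {N M : Subgroup G} (hN : N.Normal) (hM : M.Normal)
    (hi : N ⊓ M = ⊥) (hN0 : N ≠ ⊥) : M = ⊥ := by
  by_contra hM0
  apply hN0
  apply h.no_sol hN
  haveI := h.quo M hM0
  refine Group.isSolvable_of_isSolvable_injective
    (f := (QuotientGroup.mk' M).comp N.subtype) ?_
  rw [injective_iff_map_eq_one]
  rintro ⟨x, hx⟩ hx1
  have : x ∈ M := by simpa using hx1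
  have : x ∈ N ⊓ M := ⟨hx, this⟩
  rw [hi, mem_bot] at this
  exact Subtype.ext this

lemma sol_of_pg {p : ℕ} (hp : p.Prime) {N : Subgroup G} (h : IsPGroup p N) :
    Group.IsSolvable N := by
  haveI : Fact p.Prime := ⟨hp⟩
  haveI := h.isNilpotent
  infer_instance

lemma fact' (h : ∀ g : G, ∃ a ∈ A, ∃ b ∈ B, g = a * b) (g : G) : ∃ b ∈ B, ∃ a ∈ A, g = b * a := by
  obtain ⟨a, ha, b, hb, e⟩ := h g⁻¹
  exact ⟨b⁻¹, B.inv_mem hb, a⁻¹, A.inv_mem ha, by rw [← mul_inv_rev, ← e, inv_inv]⟩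

lemma pow_eq_of {p x y u v : ℕ} (hp : p.Prime) (hu : ¬ p ∣ u) (hv : ¬ p ∣ v)
    (h : p ^ x * u = p ^ y * v) : p ^ x = p ^ y := by
  apply Nat.dvd_antisymm
  · have : p ^ x ∣ p ^ y * v := h ▸ Dvd.intro _ rfl
    exact (Nat.Coprime.pow_left x ((Nat.Prime.coprime_iff_not_dvd hp).2 hv)).dvd_of_dvd_mul_right this
  · have : p ^ y ∣ p ^ x * u := h ▸ Dvd.intro _ rfl
    exact (Nat.Coprime.pow_left y ((Nat.Prime.coprime_iff_not_dvd hp).2 hu)).dvd_of_dvd_mul_right this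

open scoped Pointwise in
lemma pp_perm (hA : Group.IsNilpotent A) (hB : Group.IsNilpotent B)
    (hf : ∀ g : G, ∃ a ∈ A, ∃ b ∈ B, g = a * b) {p : ℕ} (hp : p.Prime) :
    PM (pp A p) (pp B p) := by
  obtain ⟨P, hP, hAP⟩ := exists_syl hp (pp_pg hA hp) (le_top : pp A p ≤ ⊤)
  obtain ⟨x, -, hx⟩ := hP.conj hp (pp_pg hB hp) le_top
  obtain ⟨a, ha, b, hb, rfl⟩ := hf x
  -- `cj (a*b) B0 = cj a B0 ≤ P`
  have hBR : pp B p ≤ cj a⁻¹ P := by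
    rw [cj_mul, mem_nz_cj.1 (pp_nz' B p hb)] at hx
    have := cj_mono a⁻¹ hx
    rwa [← cj_mul, inv_mul_cancel, cj_one] at this
  have hAR : pp A p ≤ cj a⁻¹ P := by
    have := cj_mono a⁻¹ hAP
    rwa [mem_nz_cj.1 (pp_nz' A p (A.inv_mem ha))] at this
  set R := cj a⁻¹ P with hR
  have hcR : Nat.card R = Nat.card P := card_cj _ _
  -- counting
  have hD : Group.IsNilpotent (A ⊓ B : Subgroup G) := nil_of_le hA inf_le_left
  have hD0 : pp (A ⊓ B) p = pp A p ⊓ pp B p := by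
    apply le_antisymm (le_inf (pp_mono inf_le_left p) (pp_mono inf_le_right p))
    rintro y ⟨h1, h2⟩
    exact mem_pp' ⟨pp_le _ _ h1, pp_le _ _ h2⟩ (pg_mem (pp_pg hA hp) h1)
  have c1 := card_prod_set A B
  have c2 : ((A : Set G) * (B : Set G) : Set G) = Set.univ := by
    ext g
    simp only [Set.mem_univ, iff_true]
    obtain ⟨a, ha, b, hb, rfl⟩ := hf g
    exact Set.mul_mem_mul ha hb
  rw [c2, Nat.card_congr (Equiv.Set.univ G), ← card_relIndex (pp_le A p),
    ← card_relIndex (pp_le B p), ← card_relIndex (pp_le (A ⊓ B) p), hD0] at c1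
  have c3 := card_relIndex (le_top : P ≤ ⊤)
  rw [card_top] at c3
  rw [← c3] at c1
  have n1 := (pp_syl hA hp).nd
  have n2 := (pp_syl hB hp).nd
  have n3 := (pp_syl hD hp).nd
  rw [hD0] at n3
  have n4 := hP.nd
  obtain ⟨α, hα⟩ := card_pow hp (pp_pg hA hp)
  obtain ⟨β, hβ⟩ := card_pow hp (pp_pg hB hp)
  obtain ⟨γ, hγ⟩ := card_pow hp (hD0 ▸ pp_pg hD hp)
  obtain ⟨δ, hδ⟩ := card_pow hp hP.pg
  have c4 : p ^ (α + β) = p ^ (δ + γ) := by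
    refine pow_eq_of hp (u := (pp A p).relIndex A * (pp B p).relIndex B)
      (v := P.relIndex ⊤ * (pp A p ⊓ pp B p).relIndex (A ⊓ B)) (hp.not_dvd_mul n1 n2)
      (hp.not_dvd_mul n4 n3) ?_
    rw [hα, hβ, hγ, hδ] at c1
    rw [pow_add, pow_add]
    linarith
  have c5 := card_prod_set (pp A p) (pp B p)
  rw [hα, hβ, ← pow_add, c4, pow_add, ← hδ, ← hγ] at c5
  have c6 := Nat.eq_of_mul_eq_mul_right Nat.card_pos c5
  have hsub : ((pp A p : Set G) * (pp B p : Set G) : Set G) ⊆ (R : Set G) := by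
    rintro _ ⟨x, hx, y, hy, rfl⟩
    exact R.mul_mem (hAR hx) (hBR hy)
  have heq : ((pp A p : Set G) * (pp B p : Set G) : Set G) = (R : Set G) := by
    apply Set.eq_of_subset_of_ncard_le hsub
    rw [← Nat.card_coe_set_eq, ← Nat.card_coe_set_eq, ← c6]
    exact hcR.le
  intro x hx y hy
  have : (x * y)⁻¹ ∈ (R : Set G) := R.inv_mem (R.mul_mem (hAR hx) (hBR hy))
  rw [← heq] at this
  obtain ⟨u, hu, v, hv, e⟩ := this
  refine ⟨v⁻¹, (pp B p).inv_mem hv, u⁻¹, (pp A p).inv_mem hu, ?_⟩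
  have e' : u * v = (x * y)⁻¹ := e
  rw [← mul_inv_rev, e', inv_inv]

lemma Mn.cop (h : Mn A B) : Nat.Coprime (Nat.card A) (Nat.card B) := by
  by_contra hc
  obtain ⟨p, hp, hpA, hpB⟩ := Nat.Prime.not_coprime_iff_dvd.1 hc
  have hB0 := pp_ne_bot h.nB hp hpB
  have hA0 := pp_ne_bot h.nA hp hpA
  have hBp := pp_pg h.nB hp
  let Q : Set (Subgroup G) := {S | IsPGroup p S ∧ ∀ g, PM (cj g S) (pp B p)}
  have hQcj : ∀ S ∈ Q, ∀ g, cj g S ∈ Q := by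
    intro S hS g
    refine ⟨pg_cj hS.1 g, fun x => ?_⟩
    rw [← cj_mul]; exact hS.2 _
  have hQA : pp A p ∈ Q := by
    refine ⟨pp_pg h.nA hp, fun g => ?_⟩
    obtain ⟨b, hb, a, ha, rfl⟩ := fact' h.fact g
    rw [cj_mul, mem_nz_cj.1 (pp_nz' A p ha)]
    have := (pp_perm h.nA h.nB h.fact hp).cj b
    rwa [mem_nz_cj.1 (pp_nz' B p hb)] at this
  obtain ⟨S, hAS, hmax⟩ := (Set.toFinite Q).exists_le_maximal hQA
  have hSQ : S ∈ Q := hmax.prop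
  have hS0 : S ≠ ⊥ := fun e => hA0 (by rw [eq_bot_iff, ← e]; exact hAS)
  have hnorm : ∀ g, ∀ b ∈ pp B p, b ∈ normalizer (cj g S : Set G) := by
    intro g b hb
    have hT := hQcj S hSQ g
    have hbT := hQcj _ hT b
    have hle : cj g S ⊔ cj b (cj g S) ≤ cj g S ⊔ pp B p := by
      refine sup_le le_sup_left ?_
      intro x hx
      have h1 := mem_cj.1 hx
      have hbm : b ∈ cj g S ⊔ pp B p := (le_sup_right : pp B p ≤ cj g S ⊔ pp B p) hb
      have h2 := mul_mem (mul_mem hbm ((le_sup_left : cj g S ≤ cj g S ⊔ pp B p) h1)) (inv_mem hbm)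
      convert h2 using 1; group
    have hpm1 : PM (cj g S) (pp B p) := by have := hT.2 1; rwa [cj_one] at this
    have hT1 : cj g S ⊔ cj b (cj g S) ∈ Q := by
      refine ⟨(hpm1.pg hp hT.1 hBp).to_le hle, fun x => ?_⟩
      have : cj x (cj g S ⊔ cj b (cj g S)) = cj x (cj g S) ⊔ cj x (cj b (cj g S)) :=
        Subgroup.map_sup _ _ _
      rw [this]
      exact (hT.2 x).sup (hbT.2 x)
    have h3 := hQcj _ hT1 g⁻¹
    have h4 : S ≤ cj g⁻¹ (cj g S ⊔ cj b (cj g S)) := by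
      have := cj_mono g⁻¹ (le_sup_left : cj g S ≤ cj g S ⊔ cj b (cj g S))
      rwa [← cj_mul, inv_mul_cancel, cj_one] at this
    have h5 := hmax.le_of_ge h3 h4
    apply nz_of_cj_le
    have h6 := cj_mono g h5
    rw [← cj_mul, mul_inv_cancel, cj_one] at h6
    exact le_sup_right.trans h6
  let K := normalClosure (pp B p : Set G)
  have hBK : pp B p ≤ K := le_normalClosure
  have hK0 : K ≠ ⊥ := fun e => hB0 (by rw [eq_bot_iff, ← e]; exact hBK)
  have hKS : ∀ g, K ≤ normalizer (cj g S : Set G) := by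
    intro g
    change Subgroup.closure _ ≤ _
    rw [closure_le]
    intro y hy
    obtain ⟨b, hb, hby⟩ := Group.mem_conjugatesOfSet_iff.1 hy
    obtain ⟨c, rfl⟩ := isConj_iff.1 hby
    have h1 := hnorm (c⁻¹ * g) b hb
    have h2 := mem_nz_cj.1 h1
    refine mem_nz_cj.2 ?_
    rw [← cj_mul] at h2 ⊢
    have h3 := congrArg (cj c) h2
    rw [← cj_mul, ← cj_mul] at h3
    convert h3 using 2 <;> group
  have hKn : K.Normal := normalClosure_normal
  have hcjK : ∀ g, cj g K = K := fun g => mem_nz_cj.1 (nz_of_normal hKn g)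
  have hSK : S ⊓ K = ⊥ := by
    have hpSK : IsPGroup p (S ⊓ K : Subgroup G) := hSQ.1.to_le inf_le_left
    obtain ⟨P, hP, -⟩ := exists_syl hp hpSK inf_le_right
    have h1 : normalClosure ((S ⊓ K : Subgroup G) : Set G) ≤ P := by
      change Subgroup.closure _ ≤ _
      rw [closure_le]
      intro y hy
      obtain ⟨b, hb, hby⟩ := Group.mem_conjugatesOfSet_iff.1 hy
      obtain ⟨c, rfl⟩ := isConj_iff.1 hby
      have h2 : cj c (S ⊓ K) ≤ P := by
        refine hP.le_of_normal hp (pg_cj hpSK c) ?_ ?_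
        · have := cj_mono c (inf_le_right : S ⊓ K ≤ K)
          rwa [hcjK] at this
        · intro k hk
          apply mem_nz
          intro x hx
          have hx' := mem_cj.1 hx
          rw [mem_cj]
          refine ⟨?_, ?_⟩
          · have : k * x * k⁻¹ ∈ cj c S := nz_conj (hKS c hk) (mem_cj.2 hx'.1)
            exact mem_cj.1 this
          · have hxK : x ∈ K := by rw [← hcjK c]; exact mem_cj.2 hx'.2
            have : k * x * k⁻¹ ∈ cj c K := by
              rw [hcjK]; exact K.mul_mem (K.mul_mem hk hxK) (K.inv_mem hk)
            exact mem_cj.1 this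
      exact h2 (conj_mem_cj hb)
    have h3 := h.no_sol (normalClosure_normal (s := ((S ⊓ K : Subgroup G) : Set G)))
      (sol_of_pg hp (hP.pg.to_le h1))
    rw [eq_bot_iff, ← h3]
    exact le_normalClosure
  have hcent : S ≤ centralizer (K : Set G) := by
    intro s hs
    rw [mem_centralizer_iff]
    intro k hk
    have h1 : k * s * k⁻¹ * s⁻¹ ∈ S ⊓ K := by
      refine ⟨S.mul_mem ?_ (S.inv_mem hs), ?_⟩
      · have := hKS 1 hk
        rw [cj_one] at this
        exact nz_conj this hs
      · have := K.mul_mem hk (hKn.conj_mem _ (K.inv_mem hk) s)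
        rw [← mul_assoc, ← mul_assoc] at this
        exact this
    rw [hSK, mem_bot] at h1
    have := mul_inv_eq_one.1 h1
    rw [mul_inv_eq_iff_eq_mul] at this
    exact this
  have hCn : (centralizer (K : Set G)).Normal := inferInstance
  have hCK : centralizer (K : Set G) ⊓ K = ⊥ := by
    apply h.no_sol inferInstance
    apply sol_of_comm
    intro x hx y hy
    exact (mem_centralizer_iff.1 hx.1 y hy.2).symm
  exact hK0 (h.inter hCn hKn hCK fun e => hS0 (by rw [eq_bot_iff, ← e]; exact hcent))

end kegel
end KW

set_option linter.all false
namespace KW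
open Subgroup

section fin
variable {G : Type*} [Group G] [Finite G] {A B : Subgroup G}

lemma Mn.symm (h : Mn A B) : Mn B A where
  nA := h.nB
  nB := h.nA
  fact := fact' h.fact
  nsol := h.nsol
  sub := fun H hH hf => h.sub H hH hf.symm
  quo := h.quo

lemma Mn.sup_top (h : Mn A B) {N : Subgroup G} (hN : N.Normal) (h0 : N ≠ ⊥) : A ⊔ N = ⊤ := by
  by_contra hne
  have h1 : Group.IsSolvable (A ⊔ N : Subgroup G) := by
    refine h.sub _ hne ?_
    intro x hx
    obtain ⟨a, ha, b, hb, e⟩ := h.fact x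
    have ha' : a ∈ A ⊔ N := (le_sup_left : A ≤ A ⊔ N) ha
    refine ⟨a, ha, ha', b, hb, ?_, e⟩
    have : b = a⁻¹ * x := by rw [e]; group
    rw [this]; exact mul_mem (inv_mem ha') hx
  apply h0
  apply h.no_sol hN
  exact Group.isSolvable_of_isSolvable_injective
    (f := Subgroup.inclusion (le_sup_right : N ≤ A ⊔ N)) (Subgroup.inclusion_injective _)

lemma Mn.index_dvd (h : Mn A B) {N : Subgroup G} (hN : N.Normal) (h0 : N ≠ ⊥) :
    Nat.card (G ⧸ N) ∣ Nat.card A := by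
  refine Subgroup.card_dvd_of_surjective ((QuotientGroup.mk' N).comp A.subtype) ?_
  intro y
  obtain ⟨x, rfl⟩ := QuotientGroup.mk'_surjective N y
  have hx : x ∈ A ⊔ N := by rw [h.sup_top hN h0]; trivial
  obtain ⟨a, ha, n, hn, rfl⟩ := Subgroup.mem_sup_of_normal_right.1 hx
  refine ⟨⟨a, ha⟩, ?_⟩
  simp [hn]

lemma Mn.simp (h : Mn A B) (N : Subgroup G) (hN : N.Normal) : N = ⊥ ∨ N = ⊤ := by
  by_cases h0 : N = ⊥
  · exact Or.inl h0
  · right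
    have h1 := Nat.dvd_gcd (h.index_dvd hN h0) (h.symm.index_dvd hN h0)
    rw [Nat.Coprime.gcd_eq_one h.cop, Nat.dvd_one] at h1
    exact Subgroup.index_eq_one.1 h1

lemma Mn.ne_bot (h : Mn A B) : A ≠ ⊥ := by
  intro hb
  apply h.nsol
  have hBt : B = ⊤ := by
    rw [eq_top_iff]
    intro x _
    obtain ⟨a, ha, b, hb', rfl⟩ := h.fact x
    rw [hb, mem_bot] at ha
    rw [ha, one_mul]; exact hb'
  have := h.nB
  subst hBt
  exact Group.isSolvable_of_surjective (f := (⊤ : Subgroup G).subtype)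
    (fun x => ⟨⟨x, trivial⟩, rfl⟩)

lemma Mn.class_pow (h : Mn A B) {q k : ℕ} (hq : q.Prime) (hB : Nat.card B = q ^ k) : False := by
  classical
  haveI := Fintype.ofFinite G
  obtain ⟨x, hxA, hx1, hxc⟩ := exists_central h.nA le_rfl (le_normalizer) h.ne_bot
  have hAC : A ≤ centralizer {x} := by
    intro a ha
    rw [mem_centralizer_singleton_iff]
    exact hxc a ha
  have hAB : A ⊓ B = ⊥ := Subgroup.inf_eq_bot_of_coprime h.cop
  have hG : Nat.card (⊤ : Subgroup G) = Nat.card A * Nat.card B :=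
    card_inj hAB le_top le_top fun g _ => h.fact g
  rw [card_top] at hG
  have hAi : A.index = Nat.card B := by
    have := A.card_mul_index
    rw [hG] at this
    exact Nat.eq_of_mul_eq_mul_left Nat.card_pos this
  have hci : (centralizer {x}).index ∣ q ^ k := by
    rw [← hB, ← hAi]; exact Subgroup.index_dvd_of_le hAC
  obtain ⟨j, -, hj⟩ := (Nat.dvd_prime_pow hq).1 hci
  let S : Finset G := Finset.univ.filter fun y => IsConj x y
  have hS : ∀ y, y ∈ S ↔ IsConj x y := fun y => by simp [S]
  refine burnside_class h.simp h.nsol hx1 S hS hq (k := j) ?_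
  rw [← hj]
  have e1 : (S : Set G) = MulAction.orbit (ConjAct G) x := by
    ext y
    rw [Finset.mem_coe, hS, ConjAct.mem_orbit_conjAct, isConj_comm]
  have e2 := MulAction.index_stabilizer (ConjAct G) x
  rw [← Set.ncard_coe_finset, e1, ← e2, ConjAct.stabilizer_eq_centralizer]
  rfl

lemma Mn.mB (h : Mn A B) (p : ℕ) : ∃ r, r.Prime ∧ r ≠ p ∧ r ∣ Nat.card B := by
  by_contra! hcon
  have h1 : ∀ {d : ℕ}, d.Prime → d ∣ Nat.card B → d = p := by
    intro d hd hdB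
    by_contra hne
    exact hcon d hd hne hdB
  by_cases hp : p.Prime
  · exact h.class_pow hp (Nat.eq_prime_pow_of_unique_prime_dvd Nat.card_pos.ne' h1)
  · refine h.class_pow Nat.prime_two (k := 0) ?_
    by_contra hne
    obtain ⟨r, hr, hrB⟩ := Nat.exists_prime_and_dvd hne
    exact hp (h1 hr hrB ▸ hr)

lemma Mn.false (h : Mn A B) : False :=
  Hyp.false (A := A) (B := B)
    { nA := h.nA, nB := h.nB, fact := h.fact, cop := h.cop, simp := h.simp, nsol := h.nsol,
      sub := h.sub, mA := h.symm.mB, mB := h.mB }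

end fin

theorem main_ind.{u} (n : ℕ) : ∀ (G : Type u) [Group G] [Finite G], Nat.card G = n →
    ∀ A B : Subgroup G, Group.IsNilpotent A → Group.IsNilpotent B →
    (∀ g : G, ∃ a ∈ A, ∃ b ∈ B, g = a * b) → Group.IsSolvable G := by
  induction n using Nat.strong_induction_on with
  | _ n ih =>
    intro G _ _ hn A B hA hB hf
    by_contra hns
    refine Mn.false (A := A) (B := B) ⟨hA, hB, hf, hns, ?_, ?_⟩
    · intro H hH hF
      refine ih (Nat.card H) ?_ H rfl (A.subgroupOf H) (B.subgroupOf H) (nil_subgroupOf hA H)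
        (nil_subgroupOf hB H) hF.sub
      rw [← hn]
      refine lt_of_le_of_ne (Subgroup.card_le_card_group H) fun e => hH ?_
      exact Subgroup.eq_top_of_card_eq H e
    · intro N hN h0
      refine ih (Nat.card (G ⧸ N)) ?_ (G ⧸ N) rfl (A.map (QuotientGroup.mk' N))
        (B.map (QuotientGroup.mk' N)) (nil_map hA _) (nil_map hB _) ?_
      · rw [← hn, Subgroup.card_eq_card_quotient_mul_card_subgroup N]
        have : 1 < Nat.card N := (Subgroup.one_lt_card_iff_ne_bot N).2 h0
        exact lt_mul_of_one_lt_right Nat.card_pos this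
      · intro y
        obtain ⟨x, rfl⟩ := QuotientGroup.mk'_surjective N y
        obtain ⟨a, ha, b, hb, rfl⟩ := hf x
        exact ⟨_, mem_map_of_mem _ ha, _, mem_map_of_mem _ hb, map_mul _ _ _⟩

end KW

theorem stmt13 {G : Type*} [Group G] [Fintype G] (A B : Subgroup G)
    (hA : Group.IsNilpotent A) (hB : Group.IsNilpotent B)
    (hfact : ∀ g : G, ∃ a ∈ A, ∃ b ∈ B, g = a * b) :
    IsSolvable G := by
  exact KW.main_ind _ G rfl A B hA hB hfact
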